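/- arXiv:1312.6886 — 11 statements merged into one kernel-verified Lean document; each statement's English description precedes it below -/
import Mathlib

section
/- Let σ be a permutation of a finite set Ω with |Ω| = n and let 0 < m < n. Then the number α_m(σ) of σ-invariant m-element subsets of Ω satisfies α_m(σ) ≤ ξ₁^{β(σ)} · e^{n·h(λ)}, where λ = m/n, ξ₁ = √(m² + (n−m)²)/n, h(p) = −p·ln p − (1−p)·ln(1−p), and β(σ) is the size of the support of σ. -/
open Finset

/-- Binary entropy function `h(p) = -p ln p - (1-p) ln(1-p)`. -/
noncomputable def binEnt (p : ℝ) : ℝ := -p * Real.log p - (1 - p) * Real.log (1 - p)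

lemma aux_pow (p q s : ℝ) (hp : 0 ≤ p) (hq : 0 ≤ q) (hs : 0 ≤ s) (h : s ^ 2 = p ^ 2 + q ^ 2)
    (k : ℕ) (hk : 2 ≤ k) : p ^ k + q ^ k ≤ s ^ k := by
  obtain ⟨j, rfl⟩ := Nat.exists_eq_add_of_le hk
  have h1 : p ≤ s := by nlinarith [sq_nonneg q]
  have h2 : q ≤ s := by nlinarith [sq_nonneg p]
  have h3 : p ^ j ≤ s ^ j := pow_le_pow_left₀ hp h1 j
  have h4 : q ^ j ≤ s ^ j := pow_le_pow_left₀ hq h2 j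
  rw [pow_add, pow_add, pow_add, h]
  nlinarith [mul_le_mul_of_nonneg_left h3 (sq_nonneg p), mul_le_mul_of_nonneg_left h4 (sq_nonneg q)]

lemma aux_main {Ω : Type*} [Fintype Ω] [DecidableEq Ω] (σ : Equiv.Perm Ω) (p q s : ℝ)
    (hp : 0 ≤ p) (hq : 0 ≤ q) (hs : 0 ≤ s) (hpq : p + q = 1) (h : s ^ 2 = p ^ 2 + q ^ 2) :
    ∑ x ∈ (univ : Finset (Finset Ω)).filter (fun x => x.image ⇑σ = x),
      ∏ ω, (if ω ∈ x then p else q) ≤ s ^ σ.support.card := by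
  classical
  let S := Quotient (Equiv.Perm.SameCycle.setoid σ)
  let mk : Ω → S := fun ω => Quotient.mk _ ω
  have hmk : ∀ a b, mk a = mk b ↔ σ.SameCycle a b := fun a b => Quotient.eq
  have hsurj : Function.Surjective mk := Quotient.mk_surjective
  let g : Finset S → Finset Ω := fun T => univ.filter (fun ω => mk ω ∈ T)
  have hg : Function.Injective g := by
    intro T U hTU
    ext c
    obtain ⟨ω, rfl⟩ := hsurj c
    have := congrArg (fun z => ω ∈ z) hTU
    simpa [g] using this
  have hsub : (univ : Finset (Finset Ω)).filter (fun x => x.image ⇑σ = x) ⊆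
      (univ : Finset (Finset S)).image g := by
    intro x hx
    have hx : x.image ⇑σ = x := by simpa using hx
    have hinv : ∀ a, σ a ∈ x ↔ a ∈ x := by
      intro a
      conv_lhs => rw [← hx]
      simp
    have hz : ∀ (k : ℕ) a, (σ ^ k) a ∈ x ↔ a ∈ x := by
      intro k
      induction k with
      | zero => simp
      | succ k ih => intro a; rw [pow_succ', Equiv.Perm.mul_apply, hinv, ih]
    simp only [mem_image, mem_univ, true_and]
    refine ⟨x.image mk, ?_⟩
    ext a
    simp only [g, mem_filter, mem_univ, true_and, mem_image]
    constructor
    · rintro ⟨b, hb, hba⟩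
      obtain ⟨k, hk⟩ := ((hmk _ _).1 hba).exists_nat_pow_eq
      rw [← hk, hz]; exact hb
    · intro ha; exact ⟨a, ha, rfl⟩
  have e1 : ∀ T : Finset S, ∏ ω, (if ω ∈ g T then p else q) =
      (∏ c ∈ T, p ^ (univ.filter (fun ω => mk ω = c)).card) *
      ∏ c ∈ univ \ T, q ^ (univ.filter (fun ω => mk ω = c)).card := by
    intro T
    rw [← Finset.prod_fiberwise univ mk, ← Finset.prod_sdiff (Finset.subset_univ T), mul_comm]
    congr 1
    · refine Finset.prod_congr rfl fun c hc => ?_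
      refine Finset.prod_eq_pow_card fun ω hω => ?_
      have : mk ω = c := by simpa using hω
      simp [g, this, hc]
    · refine Finset.prod_congr rfl fun c hc => ?_
      refine Finset.prod_eq_pow_card fun ω hω => ?_
      have h1 : mk ω = c := by simpa using hω
      have h2 : c ∉ T := by simpa using hc
      simp [g, h1, h2]
  have e2 : s ^ σ.support.card = ∏ ω, (if σ ω ≠ ω then s else 1) := by
    rw [← Finset.prod_filter, Finset.prod_const]
    congr 2
  calc _ ≤ ∑ x ∈ (univ : Finset (Finset S)).image g, ∏ ω, (if ω ∈ x then p else q) := by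
        refine Finset.sum_le_sum_of_subset_of_nonneg hsub fun x _ _ => ?_
        refine Finset.prod_nonneg fun ω _ => ?_
        split_ifs <;> assumption
    _ = ∑ T : Finset S, ∏ ω, (if ω ∈ g T then p else q) :=
        Finset.sum_image (fun _ _ _ _ hh => hg hh)
    _ = ∏ c : S, (p ^ (univ.filter (fun ω => mk ω = c)).card +
          q ^ (univ.filter (fun ω => mk ω = c)).card) := by
        rw [Finset.prod_add, Finset.powerset_univ]
        exact Finset.sum_congr rfl fun T _ => e1 T
    _ ≤ ∏ c : S, ∏ ω ∈ univ.filter (fun ω => mk ω = c), (if σ ω ≠ ω then s else 1) := by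
        refine Finset.prod_le_prod (fun c _ => by positivity) fun c _ => ?_
        obtain ⟨a, rfl⟩ := hsurj c
        by_cases ha : σ a = a
        · have : univ.filter (fun ω => mk ω = mk a) = {a} := by
            ext b
            simp only [mem_filter, mem_univ, true_and, mem_singleton, hmk]
            constructor
            · intro hb
              exact (hb.symm.eq_of_left ha).symm
            · rintro rfl; exact Equiv.Perm.SameCycle.refl _ _
          rw [this]; simp [ha, hpq]
        · rw [Finset.prod_eq_pow_card (b := s)]
          · apply aux_pow p q s hp hq hs h
            refine Finset.one_lt_card.2 ⟨a, by simp, σ a, ?_, fun hh => ha hh.symm⟩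
            simp [hmk, Equiv.Perm.SameCycle.refl]
          · intro b hb
            have hb : σ.SameCycle b a := by simpa [hmk] using hb
            rw [if_pos]
            intro hb'
            have := hb.eq_of_left hb'
            exact ha (this ▸ hb')
    _ = _ := by rw [e2, Finset.prod_fiberwise]

/-- Theorem 2.1(a): for a permutation `σ` of a set of size `n` and `0 < m < n`,
the number of `σ`-invariant `m`-element subsets is at most `ξ₁ ^ β(σ) * exp (n * h(m/n))`,
where `ξ₁ = √(m² + (n-m)²) / n` and `β(σ)` is the size of the support of `σ`. -/
theorem stmt_0 {Ω : Type*} [Fintype Ω] [DecidableEq Ω] (n m : ℕ)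
    (hn : Fintype.card Ω = n) (hm0 : 0 < m) (hmn : m < n) (σ : Equiv.Perm Ω) :
    (((univ : Finset (Finset Ω)).filter
        (fun x => x.card = m ∧ x.image ⇑σ = x)).card : ℝ) ≤
      (Real.sqrt ((m : ℝ) ^ 2 + ((n : ℝ) - m) ^ 2) / n) ^ σ.support.card *
        Real.exp (n * binEnt ((m : ℝ) / n)) := by
  have hn0 : (0:ℝ) < n := by exact_mod_cast hm0.trans hmn
  have hm0' : (0:ℝ) < m := by exact_mod_cast hm0
  have hmn' : (m:ℝ) < n := by exact_mod_cast hmn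
  obtain ⟨p, hpd⟩ : ∃ p : ℝ, p = m / n := ⟨_, rfl⟩
  have hp : 0 < p := by rw [hpd]; positivity
  have hp1 : p < 1 := by rw [hpd, div_lt_one hn0]; exact hmn'
  have hq : 0 < 1 - p := by linarith
  have hmp : (m:ℝ) = n * p := by rw [hpd]; field_simp
  rw [← hpd]
  set s := Real.sqrt ((m : ℝ) ^ 2 + ((n : ℝ) - m) ^ 2) / n with hs
  have hs2 : s ^ 2 = p ^ 2 + (1 - p) ^ 2 := by
    rw [hs, div_pow, Real.sq_sqrt (by positivity), hpd]
    field_simp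
  have key := aux_main σ p (1 - p) s hp.le hq.le (by positivity) (by ring) hs2
  have hexp : Real.exp (n * binEnt p) * (p ^ m * (1 - p) ^ (n - m)) = 1 := by
    have h1 : p ^ m * (1 - p) ^ (n - m) =
        Real.exp (m * Real.log p + ((n - m : ℕ) : ℝ) * Real.log (1 - p)) := by
      rw [Real.exp_add, Real.exp_nat_mul, Real.exp_nat_mul, Real.exp_log hp, Real.exp_log hq]
    rw [h1, ← Real.exp_add, Real.exp_eq_one_iff, Nat.cast_sub hmn.le, hmp, binEnt]
    ring
  have hw : ∀ x : Finset Ω, x.card = m →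
      ∏ ω, (if ω ∈ x then p else 1 - p) = p ^ m * (1 - p) ^ (n - m) := by
    intro x hx
    rw [Finset.prod_ite, Finset.prod_const, Finset.prod_const]
    have h1 : univ.filter (fun ω => ω ∈ x) = x := by ext; simp
    have h2 : univ.filter (fun ω => ω ∉ x) = xᶜ := by ext; simp
    rw [h1, h2, Finset.card_compl, hx, hn]
  have key2 : (((univ : Finset (Finset Ω)).filter
        (fun x => x.card = m ∧ x.image ⇑σ = x)).card : ℝ) * (p ^ m * (1 - p) ^ (n - m)) ≤
        s ^ σ.support.card := by
    refine le_trans ?_ key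
    rw [← nsmul_eq_mul, ← Finset.sum_const]
    calc _ = ∑ x ∈ (univ : Finset (Finset Ω)).filter (fun x => x.card = m ∧ x.image ⇑σ = x),
          ∏ ω, (if ω ∈ x then p else 1 - p) :=
          Finset.sum_congr rfl fun x hx => (hw x (by simp at hx; exact hx.1)).symm
      _ ≤ _ := by
          refine Finset.sum_le_sum_of_subset_of_nonneg ?_ fun x _ _ => ?_
          · intro x hx
            simp only [mem_filter, mem_univ, true_and] at hx ⊢
            exact hx.2
          · refine Finset.prod_nonneg fun ω _ => ?_
            split_ifs
            · exact hp.le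
            · exact hq.le
  have := mul_le_mul_of_nonneg_right key2 (Real.exp_pos (n * binEnt p)).le
  rwa [mul_assoc, mul_comm (p ^ m * _), hexp, mul_one] at this
end

section
/- Let σ be a permutation of a finite set Ω with |Ω| = n ≥ 1 and let m > 0. Then the number α_{(m)}(σ) of σ-invariant multisets of size m on Ω satisfies α_{(m)}(σ) ≤ ξ₂^{β(σ)} · e^{(n+m)·h(η)}, where η = m/(n+m), ξ₂ = √(n/(n+2m)), h(p) = −p·ln p − (1−p)·ln(1−p), and β(σ) is the size of the support of σ. -/
open Finset

lemma inv_sameCycle {Ω : Type*} [Fintype Ω] [DecidableEq Ω] (σ : Equiv.Perm Ω) (κ : Ω → ℕ)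
    (h : κ ∘ ⇑σ = κ) {a b : Ω} (hab : σ.SameCycle a b) : κ a = κ b := by
  obtain ⟨i, -, hi⟩ := hab.exists_pow_eq'
  have key : ∀ k : ℕ, κ ((σ ^ k) a) = κ a := by
    intro k
    induction k with
    | zero => simp
    | succ k ih =>
      rw [pow_succ', Equiv.Perm.mul_apply]
      exact (congrFun h _).trans ih
  rw [← hi, key]

lemma fixed_sameCycle {Ω : Type*} [Fintype Ω] [DecidableEq Ω] (σ : Equiv.Perm Ω)
    {a b : Ω} (hab : σ.SameCycle a b) : σ a = a ↔ σ b = b :=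
  hab.apply_eq_self_iff

lemma count_bound {Ω : Type*} [Fintype Ω] [DecidableEq Ω] (m : ℕ) (σ : Equiv.Perm Ω)
    (x s : ℝ) (hx0 : 0 < x) (hx1 : x < 1) (hs : s ^ 2 = 1 / (1 - x ^ 2)) (hs1 : 1 ≤ s) :
    ({κ : Ω → ℕ | (∑ ω, κ ω) = m ∧ κ ∘ ⇑σ = κ}.ncard : ℝ) * x ^ m ≤
      ∏ ω : Ω, (if σ ω = ω then 1 / (1 - x) else s) := by
  classical
  let S := Equiv.Perm.SameCycle.setoid σ
  let p : Ω → Quotient S := fun ω => Quotient.mk S ω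
  have hp : ∀ a b, p a = p b ↔ σ.SameCycle a b := fun a b => Quotient.eq (r := S)
  let l : Quotient S → ℕ := fun q => #{ω | p ω = q}
  let T : Finset (Quotient S → ℕ) :=
    (Fintype.piFinset fun _ => range (m + 1)).filter fun f => ∑ q, l q * f q = m
  have hout : ∀ q, p q.out = q := fun q => Quotient.out_eq q
  have hl1 : ∀ q, 1 ≤ l q := fun q => Finset.card_pos.2 ⟨q.out, by simp [hout]⟩
  have hcard : {κ : Ω → ℕ | (∑ ω, κ ω) = m ∧ κ ∘ ⇑σ = κ}.ncard ≤ #T := by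
    rw [← Set.ncard_coe_finset T]
    refine Set.ncard_le_ncard_of_injOn (fun κ q => κ q.out) ?_ ?_ T.finite_toSet
    · rintro κ ⟨h1, h2⟩
      have hsum : ∑ q, l q * κ q.out = m := by
        rw [← h1, ← Finset.sum_fiberwise (s := univ) (g := p)]
        refine Finset.sum_congr rfl fun q _ => ?_
        rw [Finset.sum_congr rfl (g := fun _ => κ q.out), Finset.sum_const, smul_eq_mul]
        intro ω hω
        refine inv_sameCycle σ κ h2 ((hp _ _).1 ?_)
        rw [hout]; simpa using hω
      simp only [T, Finset.coe_filter, Set.mem_setOf_eq, Fintype.mem_piFinset, mem_range]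
      refine ⟨fun q => ?_, hsum⟩
      have : κ q.out ≤ ∑ ω, κ ω := Finset.single_le_sum (fun _ _ => Nat.zero_le _) (mem_univ _)
      omega
    · rintro κ ⟨-, h⟩ κ' ⟨-, h'⟩ he
      funext ω
      have hc : σ.SameCycle ω (p ω).out := (hp _ _).1 (hout _).symm
      rw [inv_sameCycle σ κ h hc, inv_sameCycle σ κ' h' hc]
      exact congrFun he (p ω)
  have hfib : ∀ q, ∑ i ∈ range (m + 1), (x ^ l q) ^ i ≤
      ∏ ω with p ω = q, (if σ ω = ω then 1 / (1 - x) else s) := by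
    intro q
    have hlt : x ^ l q < 1 := pow_lt_one₀ hx0.le hx1 (by have := hl1 q; omega)
    have h1 : ∑ i ∈ range (m + 1), (x ^ l q) ^ i ≤ 1 / (1 - x ^ l q) := by
      rw [le_div_iff₀ (by linarith), mul_comm, mul_neg_geom_sum]
      have : 0 ≤ (x ^ l q) ^ (m + 1) := by positivity
      linarith
    refine h1.trans ?_
    have hsc : ∀ ω, p ω = q → σ.SameCycle q.out ω := fun ω h =>
      (hp _ _).1 (by rw [hout, h])
    by_cases hf : σ q.out = q.out
    · have hsing : ({ω | p ω = q} : Finset Ω) = {q.out} := by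
        ext ω
        simp only [mem_filter, mem_univ, true_and, mem_singleton]
        constructor
        · intro h
          exact ((hsc ω h).eq_of_left hf).symm
        · rintro rfl; exact hout q
      have : l q = 1 := by simp [l, hsing]
      rw [this, hsing]; simp [hf]
    · have h2 : 2 ≤ l q := by
        refine Finset.one_lt_card.2 ⟨q.out, by simp [hout], σ q.out, ?_, fun h => hf h.symm⟩
        simp only [mem_filter, mem_univ, true_and]
        rw [← hout q, hp, hout]
        exact (Equiv.Perm.SameCycle.refl σ _).apply_left
      rw [Finset.prod_congr rfl (g := fun _ => s), Finset.prod_const]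
      · change _ ≤ s ^ l q
        calc 1 / (1 - x ^ l q) ≤ 1 / (1 - x ^ 2) := by
              have := pow_le_pow_of_le_one hx0.le hx1.le h2
              have : x ^ 2 < 1 := pow_lt_one₀ hx0.le hx1 (by norm_num)
              exact one_div_le_one_div_of_le (by linarith) (by linarith)
          _ = s ^ 2 := hs.symm
          _ ≤ s ^ l q := pow_le_pow_right₀ hs1 h2
      · intro ω hω
        rw [if_neg]
        rw [← (hsc ω (by simpa using hω)).apply_eq_self_iff]
        exact hf
  calc ({κ : Ω → ℕ | (∑ ω, κ ω) = m ∧ κ ∘ ⇑σ = κ}.ncard : ℝ) * x ^ m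
      ≤ #T * x ^ m := by gcongr
    _ = ∑ f ∈ T, ∏ q, (x ^ l q) ^ f q := by
        rw [← nsmul_eq_mul, ← Finset.sum_const]
        refine Finset.sum_congr rfl fun f hf => ?_
        have := (Finset.mem_filter.1 hf).2
        simp only [← pow_mul]
        rw [Finset.prod_pow_eq_pow_sum, this]
    _ ≤ ∑ f ∈ Fintype.piFinset fun _ => range (m + 1), ∏ q, (x ^ l q) ^ f q :=
        Finset.sum_le_sum_of_subset_of_nonneg (Finset.filter_subset _ _)
          fun _ _ _ => Finset.prod_nonneg fun _ _ => by positivity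
    _ = ∏ q, ∑ i ∈ range (m + 1), (x ^ l q) ^ i := by
        rw [Finset.prod_univ_sum]
    _ ≤ ∏ q, ∏ ω with p ω = q, (if σ ω = ω then 1 / (1 - x) else s) :=
        Finset.prod_le_prod (fun q _ => Finset.sum_nonneg fun _ _ => by positivity)
          fun q _ => hfib q
    _ = _ := Finset.prod_fiberwise _ _ _

/-- Theorem 2.1(b): for a permutation `σ` of a set of size `n ≥ 1` and `m > 0`,
the number of `σ`-invariant multisets of size `m` on `Ω` (multiplicity functions
`κ : Ω → ℕ` with total sum `m` and `κ ∘ σ = κ`) is at most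
`ξ₂ ^ β(σ) * exp ((n+m) * h(m/(n+m)))`, where `ξ₂ = √(n/(n+2m))`. -/
theorem stmt_1 {Ω : Type*} [Fintype Ω] [DecidableEq Ω] (n m : ℕ)
    (hn : Fintype.card Ω = n) (hn1 : 1 ≤ n) (hm : 0 < m) (σ : Equiv.Perm Ω) :
    ({κ : Ω → ℕ | (∑ ω, κ ω) = m ∧ κ ∘ ⇑σ = κ}.ncard : ℝ) ≤
      Real.sqrt ((n : ℝ) / ((n : ℝ) + 2 * m)) ^ σ.support.card *
        Real.exp (((n : ℝ) + m) * binEnt ((m : ℝ) / ((n : ℝ) + m))) := by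
  have hnR : (0 : ℝ) < n := by exact_mod_cast hn1
  have hmR : (0 : ℝ) < m := by exact_mod_cast hm
  set x : ℝ := (m : ℝ) / ((n : ℝ) + m) with hx
  have hx0 : 0 < x := by positivity
  have h1x : 1 - x = n / ((n : ℝ) + m) := by rw [hx]; field_simp; ring
  have h1x0 : 0 < 1 - x := by rw [h1x]; positivity
  have hx1 : x < 1 := by linarith
  set r : ℝ := Real.sqrt ((n : ℝ) / ((n : ℝ) + 2 * m)) with hr
  have hr2 : r ^ 2 = (1 - x) / (1 + x) := by
    rw [hr, Real.sq_sqrt (by positivity), h1x, hx]; field_simp; ring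
  have hr0 : 0 < r := by rw [hr]; positivity
  have hs : (r / (1 - x)) ^ 2 = 1 / (1 - x ^ 2) := by
    have : 1 - x ^ 2 = (1 - x) * (1 + x) := by ring
    have h3 : 0 < 1 + x := by linarith
    rw [div_pow, hr2, this]; field_simp
  have hs1 : 1 ≤ r / (1 - x) := by
    have h3 : 0 < 1 - x ^ 2 := by nlinarith
    have : 1 ≤ (r / (1 - x)) ^ 2 := by
      rw [hs, le_div_iff₀ h3]; nlinarith
    exact (one_le_sq_iff₀ (by positivity)).1 this
  have key := count_bound m σ x _ hx0 hx1 hs hs1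
  have hprod : ∏ ω : Ω, (if σ ω = ω then 1 / (1 - x) else r / (1 - x)) =
      r ^ σ.support.card / (1 - x) ^ n := by
    have : ∀ ω : Ω, (if σ ω = ω then 1 / (1 - x) else r / (1 - x)) =
        (if ω ∈ σ.support then r else 1) / (1 - x) := by
      intro ω
      by_cases h : σ ω = ω <;> simp [h]
    rw [Finset.prod_congr rfl fun ω _ => this ω, Finset.prod_div_distrib, Finset.prod_const,
      Finset.card_univ, hn, Finset.prod_ite_mem, Finset.univ_inter, Finset.prod_const]
  have hexp : Real.exp (((n : ℝ) + m) * binEnt x) = 1 / ((1 - x) ^ n * x ^ m) := by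
    have e1 : ((n : ℝ) + m) * x = m := by rw [hx]; field_simp
    have e2 : ((n : ℝ) + m) * (1 - x) = n := by rw [h1x]; field_simp
    have : ((n : ℝ) + m) * binEnt x = -(n * Real.log (1 - x) + m * Real.log x) := by
      unfold binEnt
      linear_combination (-Real.log x) * e1 - Real.log (1 - x) * e2
    rw [this, Real.exp_neg, Real.exp_add, mul_comm (n : ℝ), mul_comm (m : ℝ),
      ← Real.rpow_def_of_pos h1x0, ← Real.rpow_def_of_pos hx0, Real.rpow_natCast,
      Real.rpow_natCast, one_div]
  rw [hprod] at key
  rw [hexp]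
  have hxm : 0 < x ^ m := by positivity
  rw [← le_div_iff₀ hxm] at key
  refine key.trans (le_of_eq ?_)
  field_simp
end

section
/- Let σ be a permutation of a finite set Ω with |Ω| = n. Then the total number of σ-invariant subsets of Ω (of all sizes) is at most 2^{n − β(σ)/2}, where β(σ) is the size of the support of σ. Equivalently, Σ_{m=0}^{n} α_m(σ) ≤ 2^{n − β(σ)/2}. -/
open Finset

/-- Laborde's bound (16): the total number of `σ`-invariant subsets of a set of size `n`
is at most `2 ^ (n - β(σ)/2)`, where `β(σ)` is the size of the support of `σ`. -/
theorem stmt_2 {Ω : Type*} [Fintype Ω] [DecidableEq Ω] (n : ℕ)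
    (hn : Fintype.card Ω = n) (σ : Equiv.Perm Ω) :
    (((univ : Finset (Finset Ω)).filter (fun x => x.image ⇑σ = x)).card : ℝ) ≤
      (2 : ℝ) ^ ((n : ℝ) - (σ.support.card : ℝ) / 2) := by
  classical
  -- a choice of representative for every cycle
  obtain ⟨r, hr1, hr2⟩ : ∃ r : Ω → Ω, (∀ a, σ.SameCycle (r a) a) ∧
      ∀ a b, σ.SameCycle a b → r a = r b := by
    refine ⟨fun a => (Quotient.mk (Equiv.Perm.SameCycle.setoid σ) a).out, ?_, ?_⟩
    · intro a
      exact Quotient.mk_out (s := Equiv.Perm.SameCycle.setoid σ) a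
    · intro a b h
      have : Quotient.mk (Equiv.Perm.SameCycle.setoid σ) a = Quotient.mk _ b := Quotient.sound h
      simp only [this]
  set T : Finset Ω := univ.filter (fun a => r a = a) with hT
  have hrT : ∀ a, r a ∈ T := fun a => by
    simp only [hT, mem_filter, mem_univ, true_and]
    exact hr2 _ _ (hr1 a)
  -- invariant sets are unions of cycles
  have hinv : ∀ x : Finset Ω, x.image σ = x → ∀ a b, σ.SameCycle a b → (a ∈ x ↔ b ∈ x) := by
    intro x hx
    have h1 : ∀ a, σ a ∈ x ↔ a ∈ x := by
      intro a
      conv_lhs => rw [← hx]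
      simp
    have h2 : ∀ (k : ℕ) a, (σ ^ k) a ∈ x ↔ a ∈ x := by
      intro k
      induction k with
      | zero => simp
      | succ k ih => intro a; rw [pow_succ', Equiv.Perm.mul_apply, h1, ih]
    intro a b hab
    obtain ⟨k, -, rfl⟩ := hab.exists_pow_eq'
    exact (h2 k a).symm
  have hN : ((univ : Finset (Finset Ω)).filter (fun x => x.image ⇑σ = x)).card ≤ 2 ^ T.card := by
    rw [← card_powerset]
    refine card_le_card_of_injOn (fun x => x ∩ T) ?_ ?_
    · intro x _
      simp
    · intro x hx y hy hxy
      simp only [coe_filter, mem_univ, true_and, Set.mem_ofPred_eq] at hx hy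
      ext a
      rw [← hinv x hx _ _ (hr1 a), ← hinv y hy _ _ (hr1 a)]
      have := congrArg (fun z => r a ∈ z) hxy
      simpa [hrT a] using this
  have hS : 2 * (T ∩ σ.support).card ≤ σ.support.card := by
    have hd : Disjoint (T ∩ σ.support) ((T ∩ σ.support).image σ) := by
      rw [Finset.disjoint_left]
      intro a ha himg
      obtain ⟨b, hb, rfl⟩ := mem_image.1 himg
      simp only [hT, mem_inter, mem_filter, mem_univ, true_and, Equiv.Perm.mem_support] at ha hb
      have h : r b = r (σ b) := hr2 _ _ ⟨1, by simp⟩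
      exact hb.2 (by rw [← ha.1, ← h, hb.1])
    have hc := card_le_card (s := (T ∩ σ.support) ∪ ((T ∩ σ.support).image σ)) (t := σ.support) (by
      intro a ha
      rcases mem_union.1 ha with h | h
      · exact (mem_inter.1 h).2
      · obtain ⟨b, hb, rfl⟩ := mem_image.1 h
        exact Equiv.Perm.apply_mem_support.2 (mem_inter.1 hb).2)
    rw [card_union_of_disjoint hd, card_image_of_injective _ σ.injective] at hc
    omega
  have hC : (T \ σ.support).card + σ.support.card ≤ n := by
    rw [← hn, ← card_union_of_disjoint sdiff_disjoint]
    exact card_le_univ _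
  have hTc : 2 * T.card + σ.support.card ≤ 2 * n := by
    have := card_sdiff_add_card_inter T σ.support
    omega
  have hTr : (2 : ℝ) * T.card + σ.support.card ≤ 2 * n := by exact_mod_cast hTc
  calc _ ≤ (2 : ℝ) ^ T.card := by exact_mod_cast hN
    _ = (2 : ℝ) ^ (T.card : ℝ) := (Real.rpow_natCast _ _).symm
    _ ≤ _ := Real.rpow_le_rpow_of_exponent_le (by norm_num) (by linarith)
end

section
/- Let Ω be a finite set with |Ω| = n, let K be a finite set of permutations of Ω, and let 0 < m < n. Then the number u_m^K of pairs (σ, x) with σ ∈ K, x an m-element subset of Ω, and σ(x) = x, satisfies u_m^K ≤ e^{n·h(λ)} · Σ_{σ∈K} ξ₁^{β(σ)}, where λ = m/n, ξ₁ = √(m² + (n−m)²)/n, h(p) = −p·ln p − (1−p)·ln(1−p), and β(σ) is the size of the support of σ. -/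
open Finset

lemma aux_fiber (p q ξ : ℝ) (hp : 0 ≤ p) (hq : 0 ≤ q) (hpq : p + q = 1) (hξ0 : 0 ≤ ξ)
    (hξ : ξ ^ 2 = p ^ 2 + q ^ 2) (s b : ℕ) (hs : 1 ≤ s) (hb : b ≤ s) (h1 : s = 1 → b = 0) :
    p ^ s + q ^ s ≤ ξ ^ b := by
  rcases Nat.lt_or_ge s 2 with h | h
  · have : s = 1 := by omega
    rw [h1 this, this]; simp [hpq]
  · obtain ⟨k, rfl⟩ := Nat.exists_eq_add_of_le h
    have hpξ : p ≤ ξ := by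
      exact abs_le_of_sq_le_sq' (by nlinarith [sq_nonneg q]) hξ0 |>.2
    have hqξ : q ≤ ξ := by
      exact abs_le_of_sq_le_sq' (by nlinarith [sq_nonneg p]) hξ0 |>.2
    have hξ1 : ξ ≤ 1 := by nlinarith [mul_nonneg hp hq]
    calc p ^ (2 + k) + q ^ (2 + k) = p ^ 2 * p ^ k + q ^ 2 * q ^ k := by ring
      _ ≤ p ^ 2 * ξ ^ k + q ^ 2 * ξ ^ k := by gcongr
      _ = ξ ^ (2 + k) := by rw [pow_add, hξ]; ring
      _ ≤ ξ ^ b := pow_le_pow_of_le_one hξ0 hξ1 hb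

lemma aux_perm {Ω : Type*} [Fintype Ω] [DecidableEq Ω] (m : ℕ) (σ : Equiv.Perm Ω)
    (p q ξ : ℝ) (hp : 0 ≤ p) (hq : 0 ≤ q) (hpq : p + q = 1) (hξ0 : 0 ≤ ξ)
    (hξ : ξ ^ 2 = p ^ 2 + q ^ 2) :
    ((univ.filter (fun x : Finset Ω => x.card = m ∧ x.image ⇑σ = x)).card : ℝ)
      * (p ^ m * q ^ (Fintype.card Ω - m)) ≤ ξ ^ σ.support.card := by
  classical
  let S := Equiv.Perm.SameCycle.setoid σ
  let Q := Quotient S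
  let f : Ω → Q := fun ω => Quotient.mk S ω
  have hfσ : ∀ ω, f (σ ω) = f ω := fun ω => Quotient.sound (s := S)
    (show σ.SameCycle (σ ω) ω from Equiv.Perm.sameCycle_apply_left.2 (Equiv.Perm.SameCycle.refl _ _))
  have hf : ∀ ω η, f ω = f η → σ.SameCycle ω η := fun ω η h => Quotient.exact (s := S) h
  have hsurj : Function.Surjective f := Quotient.mk_surjective
  let fib : Q → Finset Ω := fun c => univ.filter (fun ω => f ω = c)
  let g : Finset Q → Finset Ω := fun t => univ.filter (fun ω => f ω ∈ t)
  have hgcard : ∀ t, (g t).card = ∑ c ∈ t, (fib c).card := by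
    intro t
    rw [Finset.card_eq_sum_card_fiberwise (f := f) (t := t)]
    · refine Finset.sum_congr rfl fun c hc => ?_
      congr 1
      ext ω
      simp only [g, fib, mem_filter, mem_univ, true_and]
      constructor
      · exact fun h => h.2
      · exact fun h => ⟨h ▸ hc, h⟩
    · intro ω h
      simpa [g] using h
  have hgcompl : ∀ t, g (univ \ t) = (g t)ᶜ := by
    intro t; ext ω; simp [g]
  have h1 : (univ.filter (fun x : Finset Ω => x.card = m ∧ x.image ⇑σ = x)) ⊆
      (univ.filter (fun t : Finset Q => (g t).card = m)).image g := by
    intro x hx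
    simp only [mem_filter, mem_univ, true_and] at hx
    obtain ⟨hxm, hxi⟩ := hx
    have hst : ∀ ω, σ ω ∈ x ↔ ω ∈ x := by
      intro ω
      conv_lhs => rw [← hxi]
      simp
    have hz : ∀ (i : ℤ) ω, (σ ^ i) ω ∈ x ↔ ω ∈ x := by
      intro i
      induction i using Int.induction_on with
      | zero => simp
      | succ k ih => intro ω; rw [add_comm, zpow_add, zpow_one, Equiv.Perm.mul_apply, hst, ih]
      | pred k ih =>
        intro ω
        rw [← hst, ← Equiv.Perm.mul_apply, ← zpow_one_add]
        rw [show (1 + (-(k:ℤ) - 1)) = -(k:ℤ) by ring, ih]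
    have hg : g (x.image f) = x := by
      ext ω
      simp only [g, mem_filter, mem_univ, true_and, mem_image]
      constructor
      · rintro ⟨η, hη, h⟩
        obtain ⟨i, hi⟩ := hf _ _ h
        rw [← hi, hz]; exact hη
      · exact fun h => ⟨ω, h, rfl⟩
    refine mem_image.2 ⟨x.image f, ?_, hg⟩
    simp [hg, hxm]
  have h2 := (Finset.card_le_card h1).trans Finset.card_image_le
  have hw : ∀ t, (∏ c ∈ t, p ^ (fib c).card) * ∏ c ∈ univ \ t, q ^ (fib c).card
      = p ^ (g t).card * q ^ (Fintype.card Ω - (g t).card) := by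
    intro t
    rw [Finset.prod_pow_eq_pow_sum, Finset.prod_pow_eq_pow_sum, ← hgcard, ← hgcard, hgcompl,
      Finset.card_compl]
  have hb : σ.support.card = ∑ c : Q, ((fib c) ∩ σ.support).card := by
    rw [Finset.card_eq_sum_card_fiberwise (f := f) (t := univ) (by simp)]
    refine Finset.sum_congr rfl fun c _ => ?_
    congr 1
    ext ω
    simp [fib, and_comm]
  calc _ ≤ ((univ.filter (fun t : Finset Q => (g t).card = m)).card : ℝ)
        * (p ^ m * q ^ (Fintype.card Ω - m)) := by gcongr
    _ = ∑ t ∈ univ.filter (fun t : Finset Q => (g t).card = m),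
        ((∏ c ∈ t, p ^ (fib c).card) * ∏ c ∈ univ \ t, q ^ (fib c).card) := by
      rw [← nsmul_eq_mul, ← Finset.sum_const]
      refine Finset.sum_congr rfl fun t ht => ?_
      rw [hw, (mem_filter.1 ht).2]
    _ ≤ ∑ t : Finset Q,
        ((∏ c ∈ t, p ^ (fib c).card) * ∏ c ∈ univ \ t, q ^ (fib c).card) := by
      refine Finset.sum_le_sum_of_subset_of_nonneg (Finset.subset_univ _) fun t _ _ => ?_
      rw [hw]; positivity
    _ = ∏ c : Q, (p ^ (fib c).card + q ^ (fib c).card) := by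
      rw [Finset.prod_add, Finset.powerset_univ]
    _ ≤ ∏ c : Q, ξ ^ ((fib c) ∩ σ.support).card := by
      refine Finset.prod_le_prod (fun c _ => by positivity) fun c _ => ?_
      refine aux_fiber p q ξ hp hq hpq hξ0 hξ _ _ ?_ (card_le_card inter_subset_left) ?_
      · obtain ⟨ω, hω⟩ := hsurj c
        exact Finset.card_pos.2 ⟨ω, by simp [fib, hω]⟩
      · intro hs
        rw [Finset.card_eq_zero, Finset.eq_empty_iff_forall_notMem]
        intro ω hω
        rw [mem_inter, Equiv.Perm.mem_support] at hω
        refine hω.2 (Finset.card_le_one.1 hs.le _ ?_ _ hω.1)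
        have := hω.1
        simp only [fib, mem_filter, mem_univ, true_and] at this ⊢
        rw [hfσ, this]
    _ = _ := by rw [Finset.prod_pow_eq_pow_sum, ← hb]

/-- Theorem 3.1, inequality (17): for a finite set `K` of permutations of a set of size `n`
and `0 < m < n`, the number of passive pairs `(σ, x)` with `σ ∈ K` and `x` a `σ`-invariant
`m`-element subset satisfies `u_m^K ≤ exp (n h(λ)) * Σ_{σ ∈ K} ξ₁ ^ β(σ)`. -/
theorem stmt_3 {Ω : Type*} [Fintype Ω] [DecidableEq Ω] (n m : ℕ)
    (hn : Fintype.card Ω = n) (hm0 : 0 < m) (hmn : m < n)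
    (K : Finset (Equiv.Perm Ω)) :
    (((K ×ˢ (univ : Finset (Finset Ω))).filter
        (fun p => p.2.card = m ∧ p.2.image ⇑p.1 = p.2)).card : ℝ) ≤
      Real.exp (n * binEnt ((m : ℝ) / n)) *
        ∑ σ ∈ K,
          (Real.sqrt ((m : ℝ) ^ 2 + ((n : ℝ) - m) ^ 2) / n) ^ σ.support.card := by
  have hn0 : (0:ℝ) < n := by exact_mod_cast hm0.trans hmn
  have hm0' : (0:ℝ) < m := by exact_mod_cast hm0
  have hmn' : (m:ℝ) < n := by exact_mod_cast hmn
  set p : ℝ := (m:ℝ) / n with hpdef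
  set ξ : ℝ := Real.sqrt ((m : ℝ) ^ 2 + ((n : ℝ) - m) ^ 2) / n with hξdef
  have hp : 0 < p := by positivity
  have hq : 0 < 1 - p := by rw [sub_pos, hpdef, div_lt_one hn0]; exact hmn'
  have hξ0 : 0 ≤ ξ := by positivity
  have hξ : ξ ^ 2 = p ^ 2 + (1 - p) ^ 2 := by
    rw [hξdef, div_pow, Real.sq_sqrt (by positivity), hpdef]
    field_simp
  have hE : Real.exp (n * binEnt p) * (p ^ m * (1 - p) ^ (n - m)) = 1 := by
    have e1 : p ^ m = Real.exp (m * Real.log p) := by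
      rw [Real.exp_nat_mul, Real.exp_log hp]
    have e2 : (1 - p) ^ (n - m) = Real.exp (((n - m : ℕ) : ℝ) * Real.log (1 - p)) := by
      rw [Real.exp_nat_mul, Real.exp_log hq]
    have hmp : (m : ℝ) = n * p := by rw [hpdef]; field_simp
    rw [e1, e2, ← Real.exp_add, ← Real.exp_add, Real.exp_eq_one_iff, Nat.cast_sub hmn.le, hmp]
    unfold binEnt
    ring
  have hcard : ((K ×ˢ (univ : Finset (Finset Ω))).filter
        (fun p => p.2.card = m ∧ p.2.image ⇑p.1 = p.2)).card =
      ∑ σ ∈ K, (univ.filter (fun x : Finset Ω => x.card = m ∧ x.image ⇑σ = x)).card := by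
    simp only [Finset.card_filter, Finset.sum_product]
  rw [hcard, Nat.cast_sum, Finset.mul_sum]
  refine Finset.sum_le_sum fun σ _ => ?_
  have key := aux_perm m σ p (1 - p) ξ hp.le hq.le (by ring) hξ0 hξ
  rw [hn] at key
  have := mul_le_mul_of_nonneg_left key (Real.exp_pos (n * binEnt p)).le
  rw [mul_left_comm, hE, mul_one] at this
  exact this
end

section
/- Let Ω be a finite set with |Ω| = n ≥ 1, let K be a finite set of permutations of Ω, and let m > 0. Then the number u_{(m)}^K of pairs (σ, κ) with σ ∈ K and κ a σ-invariant multiset of size m on Ω satisfies u_{(m)}^K ≤ e^{(n+m)·h(η)} · Σ_{σ∈K} ξ₂^{β(σ)}, where η = m/(n+m), ξ₂ = √(n/(n+2m)), h(p) = −p·ln p − (1−p)·ln(1−p), and β(σ) is the size of the support of σ. -/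
open Finset

lemma key_ineq (x ξ : ℝ) (hx0 : 0 < x) (hx1 : x < 1) (hξ0 : 0 ≤ ξ)
    (hξ : ξ ^ 2 = (1 - x) / (1 + x)) (l : ℕ) (hl : 2 ≤ l) :
    (1 - x ^ l)⁻¹ ≤ ((1 - x)⁻¹ * ξ) ^ l := by
  have h1 : 0 < 1 - x := by linarith
  have h2 : 0 < 1 + x := by linarith
  set y := (1 - x)⁻¹ * ξ with hy
  have hy0 : 0 ≤ y := by positivity
  have hy2 : y ^ 2 = (1 - x ^ 2)⁻¹ := by
    rw [hy, mul_pow, hξ, show 1 - x ^ 2 = (1 - x) * (1 + x) by ring]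
    field_simp
  have hx2 : 0 < 1 - x ^ 2 := by nlinarith
  have hx2' : 1 - x ^ 2 ≤ 1 := by nlinarith
  have hyy : 1 ≤ y ^ 2 := by rw [hy2]; exact (one_le_inv₀ hx2).2 hx2'
  have hy1 : 1 ≤ y := by nlinarith
  have hpow : x ^ l ≤ x ^ 2 := pow_le_pow_of_le_one hx0.le hx1.le hl
  calc (1 - x ^ l)⁻¹ ≤ (1 - x ^ 2)⁻¹ := by
        apply inv_anti₀ hx2; linarith
    _ = y ^ 2 := hy2.symm
    _ ≤ y ^ l := pow_le_pow_right₀ hy1 hl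

lemma geom_bound (q : ℝ) (h0 : 0 ≤ q) (h1 : q < 1) (N : ℕ) :
    ∑ j ∈ range N, q ^ j ≤ (1 - q)⁻¹ := by
  rw [← tsum_geometric_of_lt_one h0 h1]
  exact (summable_geometric_of_lt_one h0 h1).sum_le_tsum _ (fun i _ => pow_nonneg h0 i)

open Classical in
lemma count_bound_s4 {Ω : Type*} [Fintype Ω] [DecidableEq Ω] (m : ℕ) (σ : Equiv.Perm Ω)
    (x ξ : ℝ) (hx0 : 0 < x) (hx1 : x < 1) (hξ0 : 0 ≤ ξ)
    (hξ : ξ ^ 2 = (1 - x) / (1 + x)) :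
    ((((Fintype.piFinset (fun _ : Ω => range (m + 1))).filter
      (fun κ => (∑ ω, κ ω) = m ∧ κ ∘ ⇑σ = κ)).card : ℕ) : ℝ) * x ^ m ≤
      ((1 - x)⁻¹) ^ Fintype.card Ω * ξ ^ σ.support.card := by
  set s := Equiv.Perm.SameCycle.setoid σ with hs
  let Q := Quotient s
  let π : Ω → Q := fun ω => Quotient.mk s ω
  have hπ : ∀ a b, π a = π b ↔ σ.SameCycle a b := fun a b => Quotient.eq
  let P := Fintype.piFinset (fun _ : Q => range (m + 1))
  let T := P.filter (fun f => ∑ ω, f (π ω) = m)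
  have hST : ((Fintype.piFinset (fun _ : Ω => range (m + 1))).filter
      (fun κ => (∑ ω, κ ω) = m ∧ κ ∘ ⇑σ = κ)).card ≤ T.card := by
    refine le_trans (card_le_card (t := T.image (fun f ω => f (π ω))) ?_) card_image_le
    intro κ hκ
    rw [mem_filter] at hκ
    obtain ⟨hP, hsum, hinv⟩ := hκ
    have hinv' : ∀ ω, κ (σ ω) = κ ω := fun ω => congrFun hinv ω
    have hz : ∀ a b, σ.SameCycle a b → κ a = κ b := by
      intro a b hab
      obtain ⟨i, -, rfl⟩ := hab.exists_pow_eq'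
      clear hab
      induction i with
      | zero => simp
      | succ i ih =>
        rw [pow_succ', Equiv.Perm.mul_apply, hinv']
        exact ih
    rw [mem_image]
    refine ⟨fun q => κ q.out, ?_, ?_⟩
    · have he : ∀ ω, κ (π ω).out = κ ω := fun ω =>
        hz _ _ ((hπ _ _).1 (Quotient.out_eq (π ω)))
      rw [mem_filter]
      refine ⟨?_, ?_⟩
      · rw [Fintype.mem_piFinset] at hP ⊢
        exact fun q => hP _
      · simpa only [he] using hsum
    · funext ω
      exact hz _ _ ((hπ _ _).1 (Quotient.out_eq (π ω)))
  let F : Q → Finset Ω := fun q => univ.filter (fun ω => π ω = q)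
  have hF : ∀ q, 1 ≤ (F q).card := by
    intro q
    exact card_pos.2 ⟨q.out, by simp [F, π]⟩
  have hfib : ∀ f : Q → ℕ, x ^ (∑ ω, f (π ω)) = ∏ q, (x ^ (F q).card) ^ (f q) := by
    intro f
    rw [← prod_pow_eq_pow_sum, ← prod_fiberwise univ π]
    refine prod_congr rfl fun q _ => ?_
    rw [prod_congr rfl (g := fun _ => x ^ f q) (fun ω hω => by rw [(mem_filter.1 hω).2])]
    rw [prod_const, ← pow_mul, ← pow_mul, mul_comm]
  have hy0 : 0 < (1 - x)⁻¹ := inv_pos.2 (by linarith)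
  calc _ ≤ (T.card : ℝ) * x ^ m := by
        gcongr
    _ = ∑ f ∈ T, x ^ (∑ ω, f (π ω)) := by
        rw [sum_congr rfl (g := fun _ => x ^ m) (fun f hf => by rw [(mem_filter.1 hf).2])]
        simp
    _ ≤ ∑ f ∈ P, x ^ (∑ ω, f (π ω)) :=
        sum_le_sum_of_subset_of_nonneg (filter_subset _ _) (fun _ _ _ => by positivity)
    _ = ∏ q : Q, ∑ j ∈ range (m + 1), (x ^ (F q).card) ^ j := by
        rw [prod_univ_sum]
        exact sum_congr rfl fun f _ => hfib f
    _ ≤ ∏ q : Q, ∏ ω ∈ F q, ((1 - x)⁻¹ * if ω ∈ σ.support then ξ else 1) := by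
        refine prod_le_prod (fun q _ => by positivity) fun q _ => ?_
        refine (geom_bound _ (by positivity)
          (pow_lt_one₀ hx0.le hx1 (by have := hF q; omega)) _).trans ?_
        rcases (hF q).eq_or_lt with h1 | h2
        · obtain ⟨a, ha⟩ := card_eq_one.1 h1.symm
          have haF : a ∈ F q := by rw [ha]; simp
          have hsa : σ a ∈ F q := by
            have : π (σ a) = π a := (hπ _ _).2 (Equiv.Perm.sameCycle_apply_left.2 (Equiv.Perm.SameCycle.refl _ _))
            simpa [F, this] using haF
          have : σ a = a := by rw [ha] at hsa; simpa using hsa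
          rw [← h1, ha]
          simp [this]
        · have hmem : ∀ a ∈ F q, a ∈ σ.support := by
            intro a ha
            rw [Equiv.Perm.mem_support]
            intro hfix
            obtain ⟨b, hb, hba⟩ := exists_mem_ne h2 a
            have : σ.SameCycle a b := (hπ _ _).1
              ((mem_filter.1 ha).2.trans (mem_filter.1 hb).2.symm)
            exact hba ((this.eq_of_left hfix).symm)
          rw [prod_congr rfl (g := fun _ => (1 - x)⁻¹ * ξ) (fun ω hω => by rw [if_pos (hmem ω hω)])]
          rw [prod_const]
          exact key_ineq x ξ hx0 hx1 hξ0 hξ _ h2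
    _ = ∏ ω : Ω, ((1 - x)⁻¹ * if ω ∈ σ.support then ξ else 1) := prod_fiberwise univ π _
    _ = _ := by
        rw [prod_mul_distrib, prod_const, card_univ, prod_ite_mem, univ_inter, prod_const]

/-- Theorem 3.1, inequality (18): for a finite set `K` of permutations of a set of size
`n ≥ 1` and `m > 0`, the number of passive pairs `(σ, κ)` with `σ ∈ K` and `κ` a
`σ`-invariant multiset of size `m` (a multiplicity function `κ : Ω → ℕ` with sum `m`
and `κ ∘ σ = κ`) satisfies `u_{(m)}^K ≤ exp ((n+m) h(η)) * Σ_{σ ∈ K} ξ₂ ^ β(σ)`. -/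
theorem stmt_4 {Ω : Type*} [Fintype Ω] [DecidableEq Ω] (n m : ℕ)
    (hn : Fintype.card Ω = n) (hn1 : 1 ≤ n) (hm : 0 < m)
    (K : Finset (Equiv.Perm Ω)) :
    ({p : Equiv.Perm Ω × (Ω → ℕ) |
        p.1 ∈ K ∧ (∑ ω, p.2 ω) = m ∧ p.2 ∘ ⇑p.1 = p.2}.ncard : ℝ) ≤
      Real.exp (((n : ℝ) + m) * binEnt ((m : ℝ) / ((n : ℝ) + m))) *
        ∑ σ ∈ K, Real.sqrt ((n : ℝ) / ((n : ℝ) + 2 * m)) ^ σ.support.card := by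
  classical
  have hn0 : (0 : ℝ) < n := by exact_mod_cast hn1
  have hm0 : (0 : ℝ) < m := by exact_mod_cast hm
  set x : ℝ := (m : ℝ) / ((n : ℝ) + m) with hx
  set ξ : ℝ := Real.sqrt ((n : ℝ) / ((n : ℝ) + 2 * m)) with hxi
  have hx0 : 0 < x := by positivity
  have hx1 : x < 1 := by rw [hx, div_lt_one (by positivity)]; linarith
  have h1x : 0 < 1 - x := by linarith
  have hξ : ξ ^ 2 = (1 - x) / (1 + x) := by
    rw [hxi, Real.sq_sqrt (by positivity), hx]
    field_simp
    ring
  have hexp : Real.exp (((n : ℝ) + m) * binEnt x) = (x ^ m)⁻¹ * ((1 - x)⁻¹) ^ n := by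
    have e1 : ((n : ℝ) + m) * x = m := by rw [hx]; field_simp
    have e2 : ((n : ℝ) + m) * binEnt x = -(m * Real.log x) + -(n * Real.log (1 - x)) := by
      unfold binEnt
      linear_combination (-Real.log x + Real.log (1 - x)) * e1
    rw [e2, Real.exp_add, Real.exp_neg, Real.exp_neg, Real.exp_nat_mul, Real.exp_nat_mul,
      Real.exp_log hx0, Real.exp_log h1x, inv_pow]
  let S : Equiv.Perm Ω → Finset (Ω → ℕ) := fun σ =>
    (Fintype.piFinset (fun _ : Ω => range (m + 1))).filter
      (fun κ => (∑ ω, κ ω) = m ∧ κ ∘ ⇑σ = κ)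
  have hcard : {p : Equiv.Perm Ω × (Ω → ℕ) |
        p.1 ∈ K ∧ (∑ ω, p.2 ω) = m ∧ p.2 ∘ ⇑p.1 = p.2}.ncard ≤ ∑ σ ∈ K, (S σ).card := by
    rw [← card_sigma]
    refine le_trans ?_ (card_image_le (s := K.sigma S) (f := fun p => (p.1, p.2)))
    rw [← Set.ncard_coe_finset]
    refine Set.ncard_le_ncard ?_ (Finset.finite_toSet _)
    rintro ⟨σ, κ⟩ ⟨h1, h2, h3⟩
    rw [mem_coe, mem_image]
    refine ⟨⟨σ, κ⟩, ?_, rfl⟩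
    rw [mem_sigma]
    refine ⟨h1, ?_⟩
    simp only [S, mem_filter, Fintype.mem_piFinset, mem_range]
    refine ⟨fun ω => ?_, h2, h3⟩
    have : κ ω ≤ ∑ ω, κ ω := single_le_sum (fun _ _ => Nat.zero_le _) (mem_univ ω)
    simp only at h2
    omega
  calc _ ≤ ((∑ σ ∈ K, (S σ).card : ℕ) : ℝ) := by exact_mod_cast hcard
    _ = ∑ σ ∈ K, ((S σ).card : ℝ) := by push_cast; rfl
    _ ≤ ∑ σ ∈ K, (x ^ m)⁻¹ * ((1 - x)⁻¹) ^ n * ξ ^ σ.support.card := by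
        refine sum_le_sum fun σ _ => ?_
        have h := count_bound_s4 m σ x ξ hx0 hx1 (Real.sqrt_nonneg _) hξ
        rw [hn] at h
        have hxm : 0 < x ^ m := by positivity
        rw [mul_assoc, inv_mul_eq_div, le_div_iff₀ hxm]
        convert h using 4
    _ = _ := by rw [← mul_sum, hexp]
end

section
/- Let Ω be a finite set with |Ω| = n, let K be a nonempty finite set of permutations of Ω, let μ = min_{σ∈K} β(σ) be the minimal support size over K, and let 0 < m < n. Then the number u_m^K of pairs (σ, x) with σ ∈ K, x an m-element subset of Ω, and σ(x) = x, satisfies u_m^K ≤ |K| · e^{n·h(λ)} · ξ₁^{μ}, where λ = m/n, ξ₁ = √(m² + (n−m)²)/n, and h(p) = −p·ln p − (1−p)·ln(1−p). -/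
open Finset

lemma aux_pow_s5 (a b s : ℝ) (ha : 0 ≤ a) (hb : 0 ≤ b) (hs : 0 ≤ s) (h : s ^ 2 = a ^ 2 + b ^ 2)
    (c : ℕ) (hc : 2 ≤ c) : a ^ c + b ^ c ≤ s ^ c := by
  obtain ⟨k, rfl⟩ := Nat.exists_eq_add_of_le hc
  have h1 : a ≤ s := by nlinarith [sq_nonneg b]
  have h2 : b ≤ s := by nlinarith [sq_nonneg a]
  have h3 : a ^ k ≤ s ^ k := pow_le_pow_left₀ ha h1 k
  have h4 : b ^ k ≤ s ^ k := pow_le_pow_left₀ hb h2 k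
  rw [pow_add, pow_add, pow_add, h]
  nlinarith [mul_le_mul_of_nonneg_left h3 (sq_nonneg a),
    mul_le_mul_of_nonneg_left h4 (sq_nonneg b)]

lemma aux_perm_s5 {Ω : Type*} [Fintype Ω] [DecidableEq Ω] (σ : Equiv.Perm Ω) (a b s : ℝ)
    (ha : 0 ≤ a) (hb : 0 ≤ b) (hab : a + b = 1) (hs : 0 ≤ s) (h : s ^ 2 = a ^ 2 + b ^ 2) :
    ∑ x ∈ (univ : Finset (Finset Ω)).filter (fun x => x.image ⇑σ = x),
      a ^ x.card * b ^ (xᶜ).card ≤ s ^ σ.support.card := by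
  classical
  have hs1 : s ≤ 1 := by nlinarith [mul_nonneg ha hb]
  let S : Setoid Ω := Equiv.Perm.SameCycle.setoid σ
  let mk : Ω → Quotient S := fun ω => Quotient.mk S ω
  let fib : Quotient S → Finset Ω := fun q => univ.filter (fun ω => mk ω = q)
  have hinv : ∀ x : Finset Ω, x.image ⇑σ = x → ∀ ω ω', mk ω = mk ω' → ω ∈ x → ω' ∈ x := by
    intro x hx ω ω' hq hω
    have hsc : σ.SameCycle ω ω' := Quotient.exact hq
    obtain ⟨i, -, rfl⟩ := hsc.exists_pow_eq'
    clear hq hsc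
    induction i with
    | zero => simpa using hω
    | succ i ih =>
      rw [pow_succ', Equiv.Perm.mul_apply, ← hx]
      exact mem_image_of_mem _ ih
  have hkey : ∀ x : Finset Ω, x.image ⇑σ = x → ∀ ω, mk ω ∈ x.image mk ↔ ω ∈ x := by
    intro x hx ω
    constructor
    · intro hω
      obtain ⟨ω', h1, h2⟩ := mem_image.1 hω
      exact hinv x hx _ _ h2 h1
    · exact mem_image_of_mem _
  have hprod : ∀ (c : ℝ) (x : Finset Ω) (t : Finset (Quotient S)), (∀ ω, mk ω ∈ t ↔ ω ∈ x) →
      c ^ x.card = ∏ q ∈ t, c ^ (fib q).card := by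
    intro c x t hx
    rw [prod_pow_eq_pow_sum]
    congr 1
    rw [card_eq_sum_card_fiberwise (f := mk) (t := t) (fun ω hω => (hx ω).2 hω)]
    refine sum_congr rfl fun q hq => ?_
    congr 1
    ext ω
    simp only [fib, mem_filter, mem_univ, true_and]
    constructor
    · exact fun h => h.2
    · rintro rfl
      exact ⟨(hx ω).1 hq, rfl⟩
  have hle : ∑ x ∈ (univ : Finset (Finset Ω)).filter (fun x => x.image ⇑σ = x),
      a ^ x.card * b ^ (xᶜ).card ≤ ∏ q : Quotient S, (a ^ (fib q).card + b ^ (fib q).card) := by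
    rw [prod_add]
    have hinj : Set.InjOn (fun x : Finset Ω => x.image mk)
        ((univ : Finset (Finset Ω)).filter (fun x => x.image ⇑σ = x)) := by
      intro x hx y hy hxy
      have hx' := (mem_filter.1 hx).2
      have hy' := (mem_filter.1 hy).2
      ext ω
      rw [← hkey x hx' ω, ← hkey y hy' ω]
      have : x.image mk = y.image mk := hxy
      rw [this]
    calc _ = ∑ x ∈ (univ : Finset (Finset Ω)).filter (fun x => x.image ⇑σ = x),
          (∏ q ∈ x.image mk, a ^ (fib q).card) * ∏ q ∈ univ \ x.image mk, b ^ (fib q).card := by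
          refine sum_congr rfl fun x hx => ?_
          have hx' := (mem_filter.1 hx).2
          rw [hprod a x (x.image mk) (hkey x hx'), hprod b xᶜ (univ \ x.image mk)]
          intro ω
          rw [mem_sdiff, hkey x hx' ω]
          simp
      _ = ∑ t ∈ ((univ : Finset (Finset Ω)).filter (fun x => x.image ⇑σ = x)).image
            (fun x => x.image mk),
          (∏ q ∈ t, a ^ (fib q).card) * ∏ q ∈ univ \ t, b ^ (fib q).card := by
          rw [sum_image hinj]
      _ ≤ _ := by
          refine sum_le_sum_of_subset_of_nonneg (fun t _ => by simp) fun t _ _ => ?_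
          positivity
  refine hle.trans ?_
  have hR : s ^ σ.support.card = ∏ q : Quotient S, ∏ ω ∈ fib q, (if ω ∈ σ.support then s else 1) := by
    have := prod_fiberwise (univ : Finset Ω) mk (fun ω => if ω ∈ σ.support then s else 1)
    rw [this, prod_ite, filter_univ_mem]
    simp
  rw [hR]
  refine prod_le_prod (fun q _ => by positivity) fun q _ => ?_
  obtain ⟨ω, rfl⟩ := Quotient.exists_rep q
  have hω : ω ∈ fib (Quotient.mk S ω) := by simp [fib, mk]
  have hpos : 0 < (fib (Quotient.mk S ω)).card := card_pos.2 ⟨ω, hω⟩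
  rcases Nat.lt_or_ge (fib (Quotient.mk S ω)).card 2 with hc | hc
  · have hc1 : (fib (Quotient.mk S ω)).card = 1 := by omega
    obtain ⟨z, hz⟩ := card_eq_one.1 hc1
    have hσω : σ ω ∈ fib (Quotient.mk S ω) := by
      simp only [fib, mem_filter, mem_univ, true_and]
      refine Quotient.sound ?_
      change σ.SameCycle (σ ω) ω
      exact Equiv.Perm.sameCycle_apply_left.2 (Equiv.Perm.SameCycle.refl _ _)
    rw [hc1, hz, prod_singleton, pow_one, pow_one, hab]
    rw [hz, mem_singleton] at hω hσω
    subst hω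
    simp [hσω]
  · refine (aux_pow_s5 a b s ha hb hs h _ hc).trans ?_
    rw [← prod_const]
    refine prod_le_prod (fun _ _ => hs) fun i _ => ?_
    split_ifs
    · exact le_rfl
    · exact hs1

/-- Theorem 3.2, inequality (20): for a nonempty finite set `K` of permutations of a set
of size `n`, with minimal degree `μ = min_{σ ∈ K} β(σ)`, and `0 < m < n`, the number of
passive pairs `(σ, x)` with `σ ∈ K`, `x` a `σ`-invariant `m`-subset, satisfies
`u_m^K ≤ |K| * exp (n h(λ)) * ξ₁ ^ μ`. -/
theorem stmt_5 {Ω : Type*} [Fintype Ω] [DecidableEq Ω] (n m : ℕ)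
    (hn : Fintype.card Ω = n) (hm0 : 0 < m) (hmn : m < n)
    (K : Finset (Equiv.Perm Ω)) (hK : K.Nonempty) (μ : ℕ)
    (hμ : μ = sInf {k : ℕ | ∃ σ ∈ K, σ.support.card = k}) :
    (((K ×ˢ (univ : Finset (Finset Ω))).filter
        (fun p => p.2.card = m ∧ p.2.image ⇑p.1 = p.2)).card : ℝ) ≤
      (K.card : ℝ) * Real.exp (n * binEnt ((m : ℝ) / n)) *
        (Real.sqrt ((m : ℝ) ^ 2 + ((n : ℝ) - m) ^ 2) / n) ^ μ := by
  have hm' : (0:ℝ) < m := by exact_mod_cast hm0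
  have hmn' : (m:ℝ) < n := by exact_mod_cast hmn
  have hn' : (0:ℝ) < n := hm'.trans hmn'
  set a : ℝ := (m:ℝ) / n with ha
  have ha0 : 0 < a := by positivity
  have hb0 : 0 < 1 - a := by
    rw [ha, sub_pos, div_lt_one hn']; exact hmn'
  set s : ℝ := Real.sqrt ((m : ℝ) ^ 2 + ((n : ℝ) - m) ^ 2) / n with hsdef
  have hs0 : 0 ≤ s := by positivity
  have hs2 : s ^ 2 = a ^ 2 + (1 - a) ^ 2 := by
    rw [hsdef, div_pow, Real.sq_sqrt (by positivity), ha]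
    field_simp
  have hs1 : s ≤ 1 := by nlinarith [mul_nonneg ha0.le hb0.le]
  have hexp : Real.exp (n * binEnt a) * (a ^ m * (1 - a) ^ (n - m)) = 1 := by
    have e1 : a ^ m = Real.exp (m * Real.log a) := by
      rw [Real.exp_nat_mul, Real.exp_log ha0]
    have e2 : (1 - a) ^ (n - m) = Real.exp (((n - m : ℕ) : ℝ) * Real.log (1 - a)) := by
      rw [Real.exp_nat_mul, Real.exp_log hb0]
    rw [e1, e2, ← Real.exp_add, ← Real.exp_add, Real.exp_eq_one_iff, Nat.cast_sub hmn.le, binEnt]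
    have : (m : ℝ) = n * a := by rw [ha]; field_simp
    rw [this]; ring
  have hσ : ∀ σ ∈ K, ((((univ : Finset (Finset Ω)).filter
      (fun x => x.card = m ∧ x.image ⇑σ = x)).card : ℕ) : ℝ) ≤
      Real.exp (n * binEnt a) * s ^ μ := by
    intro σ hσK
    have h1 := aux_perm_s5 σ a (1 - a) s ha0.le hb0.le (by ring) hs0 hs2
    have h2 : s ^ σ.support.card ≤ s ^ μ := by
      refine pow_le_pow_of_le_one hs0 hs1 ?_
      rw [hμ]
      exact Nat.sInf_le ⟨σ, hσK, rfl⟩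
    have h3 : ((((univ : Finset (Finset Ω)).filter
      (fun x => x.card = m ∧ x.image ⇑σ = x)).card : ℕ) : ℝ) * (a ^ m * (1 - a) ^ (n - m)) ≤
      ∑ x ∈ (univ : Finset (Finset Ω)).filter (fun x => x.image ⇑σ = x),
      a ^ x.card * (1 - a) ^ (xᶜ).card := by
      rw [← nsmul_eq_mul, ← sum_const]
      calc _ = ∑ x ∈ (univ : Finset (Finset Ω)).filter
            (fun x => x.card = m ∧ x.image ⇑σ = x), a ^ x.card * (1 - a) ^ (xᶜ).card := by
            refine sum_congr rfl fun x hx => ?_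
            rw [card_compl, hn, (mem_filter.1 hx).2.1]
        _ ≤ _ := by
            refine sum_le_sum_of_subset_of_nonneg (fun x hx => ?_) fun x _ _ => ?_
            · exact mem_filter.2 ⟨mem_univ _, (mem_filter.1 hx).2.2⟩
            · positivity
    have h4 := mul_le_mul_of_nonneg_left (h3.trans (h1.trans h2))
      (Real.exp_pos (n * binEnt a)).le
    refine le_trans (le_of_eq ?_) h4
    rw [mul_left_comm, hexp, mul_one]
  have hcount : ((K ×ˢ (univ : Finset (Finset Ω))).filter
        (fun p => p.2.card = m ∧ p.2.image ⇑p.1 = p.2)).card =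
      ∑ σ ∈ K, ((univ : Finset (Finset Ω)).filter
      (fun x => x.card = m ∧ x.image ⇑σ = x)).card := by
    simp only [card_filter, sum_product]
  rw [hcount, Nat.cast_sum]
  refine (sum_le_sum hσ).trans (le_of_eq ?_)
  rw [sum_const, nsmul_eq_mul, mul_assoc]
end

section
/- Let Ω be a finite set with |Ω| = n ≥ 1, let K be a nonempty finite set of permutations of Ω, let μ = min_{σ∈K} β(σ) be the minimal support size over K, and let m > 0. Then the number u_{(m)}^K of pairs (σ, κ) with σ ∈ K and κ a σ-invariant multiset of size m on Ω satisfies u_{(m)}^K ≤ |K| · e^{(n+m)·h(η)} · ξ₂^{μ}, where η = m/(n+m), ξ₂ = √(n/(n+2m)), and h(p) = −p·ln p − (1−p)·ln(1−p). -/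
open Finset

/-- Weight of a point: `1/(1-x)` if fixed, `1/√(1-x²)` otherwise. -/
noncomputable def ptWeight {Ω : Type*} [DecidableEq Ω] (σ : Equiv.Perm Ω) (x : ℝ) (ω : Ω) : ℝ :=
  if σ ω = ω then (1 - x)⁻¹ else (Real.sqrt (1 - x ^ 2))⁻¹

lemma sqrt_pow_le (x : ℝ) (h0 : 0 < x) (h1 : x < 1) (l : ℕ) (hl : 2 ≤ l) :
    Real.sqrt (1 - x ^ 2) ^ l ≤ 1 - x ^ l := by
  have hx2 : x ^ 2 < 1 := by nlinarith
  have hs0 : 0 ≤ Real.sqrt (1 - x ^ 2) := Real.sqrt_nonneg _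
  have hs1 : Real.sqrt (1 - x ^ 2) ≤ 1 := by
    rw [Real.sqrt_le_one]; nlinarith
  have h2 : Real.sqrt (1 - x ^ 2) ^ 2 = 1 - x ^ 2 := Real.sq_sqrt (by linarith)
  have h3 := pow_le_pow_of_le_one hs0 hs1 hl
  have h4 := pow_le_pow_of_le_one h0.le h1.le hl
  linarith

lemma fiber_le {Ω : Type*} [Fintype Ω] [DecidableEq Ω] (σ : Equiv.Perm Ω) (x : ℝ)
    (h0 : 0 < x) (h1 : x < 1) (T : Finset Ω) (a : Ω) (hT : ∀ b, b ∈ T ↔ σ.SameCycle a b) :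
    (1 - x ^ T.card)⁻¹ ≤ ∏ ω ∈ T, ptWeight σ x ω := by
  have ha : a ∈ T := (hT a).2 (Equiv.Perm.SameCycle.refl _ _)
  by_cases hf : σ a = a
  · have : T = {a} := by
      ext b
      rw [hT, mem_singleton]
      constructor
      · intro h
        exact (h.eq_of_left hf).symm
      · rintro rfl; exact Equiv.Perm.SameCycle.refl _ _
    rw [this]; simp [ptWeight, hf]
  · have hall : ∀ b ∈ T, σ b ≠ b := by
      intro b hb hfb
      have h := (hT b).1 hb
      have := h.eq_of_right hfb
      subst this
      exact hf hfb
    have hcard : 2 ≤ T.card := by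
      have : 1 < T.card := Finset.one_lt_card.2
        ⟨σ a, (hT _).2 (Equiv.Perm.sameCycle_apply_right.2 (Equiv.Perm.SameCycle.refl _ _)),
          a, ha, hf⟩
      omega
    have : ∏ ω ∈ T, ptWeight σ x ω = (Real.sqrt (1 - x ^ 2) ^ T.card)⁻¹ := by
      rw [← inv_pow, ← Finset.prod_const]
      apply Finset.prod_congr rfl
      intro b hb
      simp [ptWeight, hall b hb]
    rw [this]
    have hpos : 0 < Real.sqrt (1 - x ^ 2) := Real.sqrt_pos.2 (by nlinarith)
    exact inv_anti₀ (by positivity) (sqrt_pow_le x h0 h1 _ hcard)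

lemma perm_bound {Ω : Type*} [Fintype Ω] [DecidableEq Ω] (σ : Equiv.Perm Ω) (m : ℕ) (x : ℝ)
    (h0 : 0 < x) (h1 : x < 1) :
    ∃ G : Finset (Ω → ℕ), (∀ κ : Ω → ℕ, ∑ ω, κ ω = m → κ ∘ ⇑σ = κ → κ ∈ G) ∧
      (G.card : ℝ) * x ^ m ≤ ∏ ω, ptWeight σ x ω := by
  classical
  let Q := Quotient (Equiv.Perm.SameCycle.setoid σ)
  let _ : Fintype Q := Fintype.ofFinite Q
  let π : Ω → Q := fun ω => Quotient.mk _ ω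
  let T : Q → Finset Ω := fun q => univ.filter (fun ω => π ω = q)
  let P : Finset (Q → ℕ) := Fintype.piFinset (fun _ => range (m + 1))
  let F : Finset (Q → ℕ) := P.filter (fun f => ∑ q, (T q).card * f q = m)
  refine ⟨F.image (fun f ω => f (π ω)), ?_, ?_⟩
  · intro κ hsum hinv
    have hpow : ∀ a b, σ.SameCycle a b → κ a = κ b := by
      rintro a b h
      obtain ⟨i, -, -, rfl⟩ := h.exists_pow_eq'
      clear h
      induction i with
      | zero => simp
      | succ i ih =>
        rw [pow_succ', Equiv.Perm.mul_apply, ih]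
        exact (congrFun hinv _).symm
    let f : Q → ℕ := Quotient.lift κ (fun a b h => hpow a b h)
    have hf : ∀ ω, f (π ω) = κ ω := fun ω => rfl
    rw [mem_image]
    refine ⟨f, ?_, funext hf⟩
    rw [mem_filter, Fintype.mem_piFinset]
    constructor
    · intro q
      obtain ⟨a, rfl⟩ := Quotient.exists_rep q
      rw [mem_range]
      have : κ a ≤ ∑ ω, κ ω := Finset.single_le_sum (fun _ _ => Nat.zero_le _) (mem_univ a)
      have h := hf a
      change f (π a) < m + 1
      omega
    · rw [← hsum, ← Finset.sum_fiberwise univ π κ]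
      apply Finset.sum_congr rfl
      intro q _
      rw [← smul_eq_mul, ← Finset.sum_const]
      apply Finset.sum_congr rfl
      intro ω hω
      rw [← hf ω, (mem_filter.1 hω).2]
  · have hc : ((F.image (fun f ω => f (π ω))).card : ℝ) ≤ F.card := by
      exact_mod_cast Finset.card_image_le
    have hl : ∀ q, 1 ≤ (T q).card := by
      intro q
      obtain ⟨a, rfl⟩ := Quotient.exists_rep q
      exact Finset.card_pos.2 ⟨a, mem_filter.2 ⟨mem_univ _, rfl⟩⟩
    calc ((F.image (fun f ω => f (π ω))).card : ℝ) * x ^ m ≤ F.card * x ^ m := by gcongr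
      _ = ∑ f ∈ F, ∏ q, (x ^ (T q).card) ^ f q := by
        rw [← nsmul_eq_mul, ← Finset.sum_const]
        apply Finset.sum_congr rfl
        intro f hf
        rw [← (mem_filter.1 hf).2, ← Finset.prod_pow_eq_pow_sum]
        apply Finset.prod_congr rfl
        intro q _
        rw [pow_mul]
      _ ≤ ∑ f ∈ P, ∏ q, (x ^ (T q).card) ^ f q := by
        apply Finset.sum_le_sum_of_subset_of_nonneg (Finset.filter_subset _ _)
        intros; positivity
      _ = ∏ q, ∑ i ∈ range (m + 1), (x ^ (T q).card) ^ i := by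
        rw [Finset.prod_univ_sum]
      _ ≤ ∏ q, ∏ ω ∈ T q, ptWeight σ x ω := by
        apply Finset.prod_le_prod
        · intros; positivity
        · intro q _
          have hy1 : x ^ (T q).card < 1 := pow_lt_one₀ h0.le h1 (by have := hl q; omega)
          have hy0 : 0 ≤ x ^ (T q).card := by positivity
          refine le_trans (b := (1 - x ^ (T q).card)⁻¹) ?_ ?_
          · rw [← tsum_geometric_of_lt_one hy0 hy1]
            exact (summable_geometric_of_lt_one hy0 hy1).sum_le_tsum _
              (fun i _ => by positivity)
          · obtain ⟨a, rfl⟩ := Quotient.exists_rep q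
            apply fiber_le σ x h0 h1 _ a
            intro b
            change b ∈ univ.filter (fun ω => π ω = π a) ↔ _
            rw [mem_filter]
            constructor
            · rintro ⟨-, h⟩
              exact (Quotient.exact h : σ.SameCycle b a).symm
            · intro h
              exact ⟨mem_univ _, Quotient.sound (s := Equiv.Perm.SameCycle.setoid σ) h.symm⟩
      _ = ∏ ω, ptWeight σ x ω := Finset.prod_fiberwise univ π _

lemma prod_weight {Ω : Type*} [Fintype Ω] [DecidableEq Ω] (σ : Equiv.Perm Ω) (x : ℝ)
    (h0 : 0 < x) (h1 : x < 1) :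
    ∏ ω, ptWeight σ x ω =
      (1 - x)⁻¹ ^ Fintype.card Ω * Real.sqrt ((1 - x) / (1 + x)) ^ σ.support.card := by
  have hs : (Real.sqrt (1 - x ^ 2))⁻¹ = (1 - x)⁻¹ * Real.sqrt ((1 - x) / (1 + x)) := by
    have e : (1 - x) / (1 + x) = (1 - x) ^ 2 / (1 - x ^ 2) := by
      have : 1 - x ≠ 0 := by linarith
      have : 1 + x ≠ 0 := by linarith
      have : 1 - x ^ 2 ≠ 0 := by nlinarith
      field_simp
      ring
    rw [e, Real.sqrt_div (by positivity), Real.sqrt_sq (by linarith)]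
    have : 1 - x ≠ 0 := by linarith
    field_simp
  have : ∀ ω, ptWeight σ x ω =
      (1 - x)⁻¹ * (if ω ∈ σ.support then Real.sqrt ((1 - x) / (1 + x)) else 1) := by
    intro ω
    by_cases h : σ ω = ω <;> simp [ptWeight, h, hs]
  simp_rw [this]
  rw [Finset.prod_mul_distrib, Finset.prod_const, Finset.card_univ, Finset.prod_ite_mem,
    Finset.univ_inter, Finset.prod_const]

/-- Theorem 3.2, inequality (21): for a nonempty finite set `K` of permutations of a set
of size `n ≥ 1`, with minimal degree `μ = min_{σ ∈ K} β(σ)`, and `m > 0`, the number of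
passive pairs `(σ, κ)` with `σ ∈ K` and `κ` a `σ`-invariant multiset of size `m`
satisfies `u_{(m)}^K ≤ |K| * exp ((n+m) h(η)) * ξ₂ ^ μ`. -/
theorem stmt_6 {Ω : Type*} [Fintype Ω] [DecidableEq Ω] (n m : ℕ)
    (hn : Fintype.card Ω = n) (hn1 : 1 ≤ n) (hm : 0 < m)
    (K : Finset (Equiv.Perm Ω)) (hK : K.Nonempty) (μ : ℕ)
    (hμ : μ = sInf {k : ℕ | ∃ σ ∈ K, σ.support.card = k}) :
    ({p : Equiv.Perm Ω × (Ω → ℕ) |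
        p.1 ∈ K ∧ (∑ ω, p.2 ω) = m ∧ p.2 ∘ ⇑p.1 = p.2}.ncard : ℝ) ≤
      (K.card : ℝ) * Real.exp (((n : ℝ) + m) * binEnt ((m : ℝ) / ((n : ℝ) + m))) *
        Real.sqrt ((n : ℝ) / ((n : ℝ) + 2 * m)) ^ μ := by
  classical
  have hn0 : (0 : ℝ) < n := by exact_mod_cast hn1
  have hm0 : (0 : ℝ) < m := by exact_mod_cast hm
  obtain ⟨x, hx⟩ : ∃ x : ℝ, x = (m : ℝ) / ((n : ℝ) + m) := ⟨_, rfl⟩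
  have h0 : 0 < x := by rw [hx]; positivity
  have hx1 : 1 - x = n / ((n : ℝ) + m) := by rw [hx]; field_simp; ring
  have h1 : x < 1 := by
    have : 0 < 1 - x := by rw [hx1]; positivity
    linarith
  have hξ : (1 - x) / (1 + x) = (n : ℝ) / ((n : ℝ) + 2 * m) := by
    rw [hx1, hx]; field_simp; ring
  have hexp : Real.exp (((n : ℝ) + m) * binEnt x) = (x ^ m)⁻¹ * (1 - x)⁻¹ ^ n := by
    have e : ((n : ℝ) + m) * binEnt x = -(m * Real.log x) + -(n * Real.log (1 - x)) := by
      have a1 : ((n : ℝ) + m) * x = m := by rw [hx]; field_simp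
      have a2 : ((n : ℝ) + m) * (1 - x) = n := by rw [hx1]; field_simp
      unfold binEnt
      linear_combination (-Real.log x) * a1 - Real.log (1 - x) * a2
    rw [e, Real.exp_add, Real.exp_neg, Real.exp_neg, Real.exp_nat_mul, Real.exp_nat_mul,
      Real.exp_log h0, Real.exp_log (by linarith), inv_pow]
  rw [← hx, hexp, ← hξ]
  set ξ := Real.sqrt ((1 - x) / (1 + x)) with hξd
  have hξ0 : 0 ≤ ξ := Real.sqrt_nonneg _
  have hξ1 : ξ ≤ 1 := by
    rw [hξd, Real.sqrt_le_one, div_le_one (by linarith)]; linarith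
  choose G hG1 hG2 using fun σ : Equiv.Perm Ω => perm_bound σ m x h0 h1
  have hsub : {p : Equiv.Perm Ω × (Ω → ℕ) |
        p.1 ∈ K ∧ (∑ ω, p.2 ω) = m ∧ p.2 ∘ ⇑p.1 = p.2} ⊆
      ((K.biUnion (fun σ => (G σ).image (Prod.mk σ)) : Finset _) : Set _) := by
    rintro ⟨σ, κ⟩ ⟨a, b, c⟩
    rw [Finset.mem_coe, mem_biUnion]
    exact ⟨σ, a, mem_image.2 ⟨κ, hG1 σ κ b c, rfl⟩⟩
  have hcard := Set.ncard_le_ncard hsub (Finset.finite_toSet _)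
  rw [Set.ncard_coe_finset] at hcard
  have hcard2 : (K.biUnion (fun σ => (G σ).image (Prod.mk σ))).card ≤ ∑ σ ∈ K, (G σ).card :=
    Finset.card_biUnion_le.trans (Finset.sum_le_sum fun σ _ => Finset.card_image_le)
  have hfin : ∀ σ ∈ K, ((G σ).card : ℝ) ≤ (x ^ m)⁻¹ * (1 - x)⁻¹ ^ n * ξ ^ μ := by
    intro σ hσ
    have hle : μ ≤ σ.support.card := by
      rw [hμ]; exact Nat.sInf_le ⟨σ, hσ, rfl⟩
    have h := hG2 σ
    rw [prod_weight σ x h0 h1, hn] at h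
    have hxm : 0 < x ^ m := by positivity
    have hx1' : 0 ≤ (1 - x)⁻¹ ^ n := pow_nonneg (inv_nonneg.2 (by linarith)) _
    have h2 : ((G σ).card : ℝ) * x ^ m ≤ (1 - x)⁻¹ ^ n * ξ ^ μ :=
      h.trans (mul_le_mul_of_nonneg_left (pow_le_pow_of_le_one hξ0 hξ1 hle) hx1')
    rw [mul_assoc, inv_mul_eq_div, le_div_iff₀ hxm]
    exact h2
  have hs := Finset.sum_le_card_nsmul K _ _ hfin
  rw [nsmul_eq_mul] at hs
  have hc : ({p : Equiv.Perm Ω × (Ω → ℕ) |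
        p.1 ∈ K ∧ (∑ ω, p.2 ω) = m ∧ p.2 ∘ ⇑p.1 = p.2}.ncard : ℝ) ≤
      ∑ σ ∈ K, ((G σ).card : ℝ) := by exact_mod_cast hcard.trans hcard2
  calc _ ≤ _ := hc
    _ ≤ _ := hs
    _ = _ := by ring
end

section
/- Let G be a nontrivial subgroup of the symmetric group of a finite set Ω with |Ω| = n ≥ 1, and let μ = min_{g∈G, g≠e} β(g) be the minimal degree of G. For the natural action of G on the multisets of size m > 0 on Ω, the average stabilizer size ⟨Stab⟩_{(m)} satisfies (⟨Stab⟩_{(m)} − 1)/|G| < 3·√(m(n+m)/n) · ξ₂^{μ}, where ξ₂ = √(n/(n+2m)). -/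
open Finset

lemma aux_stirling (n m : ℕ) (hn : 1 ≤ n) (hm : 1 ≤ m) :
    ((n : ℝ) + m) ^ (n + m) * (n.factorial * m.factorial) ≤
      3 * Real.sqrt ((m : ℝ) * n / (n + m)) * ((m : ℝ) ^ m * (n : ℝ) ^ n) * (n + m).factorial := by
  have hS : ∀ k : ℕ, 1 ≤ k → (k.factorial : ℝ) =
      Stirling.stirlingSeq k * (Real.sqrt (2 * k) * ((k : ℝ) ^ k / Real.exp 1 ^ k)) := by
    intro k hk
    have hk' : (0 : ℝ) < k := by exact_mod_cast hk
    unfold Stirling.stirlingSeq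
    rw [← div_pow]
    field_simp
  have hle : ∀ k : ℕ, 1 ≤ k → Stirling.stirlingSeq k ≤ Real.exp 1 / Real.sqrt 2 := by
    intro k hk
    have := Stirling.stirlingSeq'_antitone (Nat.zero_le (k - 1))
    simp only [Function.comp] at this
    rw [Nat.succ_eq_add_one, Nat.succ_eq_add_one, Nat.sub_add_cancel hk] at this
    simpa using this
  have hge := Stirling.sqrt_pi_le_stirlingSeq (n := n + m) (by omega)
  have hpos : ∀ k : ℕ, 1 ≤ k → 0 ≤ Stirling.stirlingSeq k := by
    intro k hk
    exact (Real.sqrt_nonneg _).trans (Stirling.sqrt_pi_le_stirlingSeq (by omega))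
  have hn' : (0 : ℝ) < n := by exact_mod_cast hn
  have hm' : (0 : ℝ) < m := by exact_mod_cast hm
  have hnum : Stirling.stirlingSeq n * Stirling.stirlingSeq m * Real.sqrt 2 ≤
      3 * Stirling.stirlingSeq (n + m) := by
    have h1 : Stirling.stirlingSeq n * Stirling.stirlingSeq m ≤
        (Real.exp 1 / Real.sqrt 2) * (Real.exp 1 / Real.sqrt 2) :=
      mul_le_mul (hle n hn) (hle m hm) (hpos m hm) (by positivity)
    have h2 : (Real.exp 1 / Real.sqrt 2) * (Real.exp 1 / Real.sqrt 2) = Real.exp 1 ^ 2 / 2 := by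
      rw [div_mul_div_comm, Real.mul_self_sqrt (by norm_num)]; ring
    have h3 : Real.exp 1 ^ 2 ≤ 7.3891 := by
      have := Real.exp_one_lt_d9
      have := Real.exp_pos 1
      nlinarith
    have h4 : Real.sqrt 2 ≤ 1.4143 := by
      rw [Real.sqrt_le_left (by norm_num)]; norm_num
    have h5 : 1.772 ≤ Real.sqrt Real.pi := by
      apply Real.le_sqrt_of_sq_le
      have := Real.pi_gt_d4
      norm_num at this ⊢
      linarith
    have h6 : Stirling.stirlingSeq n * Stirling.stirlingSeq m ≤ 7.3891 / 2 := by linarith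
    calc _ ≤ (7.3891 / 2 : ℝ) * 1.4143 := by gcongr
      _ ≤ 3 * 1.772 := by norm_num
      _ ≤ _ := by linarith
  have hq : Real.sqrt (2 * n) * Real.sqrt (2 * m) = Real.sqrt 2 * Real.sqrt (2 * (m * n)) := by
    rw [← Real.sqrt_mul (by positivity), ← Real.sqrt_mul (by positivity)]
    congr 1; ring
  have hq2 : Real.sqrt ((m : ℝ) * n / (n + m)) * Real.sqrt (2 * ((n : ℝ) + m)) =
      Real.sqrt (2 * (m * n)) := by
    rw [← Real.sqrt_mul (by positivity)]
    congr 1; field_simp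
  rw [hS n hn, hS m hm, hS (n + m) (by omega)]
  push_cast
  calc _ = (Stirling.stirlingSeq n * Stirling.stirlingSeq m) *
        (Real.sqrt (2 * n) * Real.sqrt (2 * m)) *
        (((n : ℝ) + m) ^ (n + m) * (m : ℝ) ^ m * (n : ℝ) ^ n / Real.exp 1 ^ (n + m)) := by
        rw [pow_add (Real.exp 1)]; field_simp
    _ = (Stirling.stirlingSeq n * Stirling.stirlingSeq m * Real.sqrt 2) *
        (Real.sqrt (2 * (m * n)) *
        (((n : ℝ) + m) ^ (n + m) * (m : ℝ) ^ m * (n : ℝ) ^ n / Real.exp 1 ^ (n + m))) := by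
        rw [hq]; ring
    _ ≤ (3 * Stirling.stirlingSeq (n + m)) *
        (Real.sqrt (2 * (m * n)) *
        (((n : ℝ) + m) ^ (n + m) * (m : ℝ) ^ m * (n : ℝ) ^ n / Real.exp 1 ^ (n + m))) := by
        gcongr
    _ = _ := by rw [← hq2]; ring

lemma aux_binom (n m : ℕ) (hn : 1 ≤ n) (hm : 1 ≤ m) :
    (1 / (1 - (m : ℝ) / (n + m))) ^ n ≤
      3 * Real.sqrt ((m : ℝ) * ((n : ℝ) + m) / n) * ((n + m - 1).choose m : ℝ) *
        ((m : ℝ) / (n + m)) ^ m := by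
  have hn' : (0 : ℝ) < n := by exact_mod_cast hn
  have hm' : (0 : ℝ) < m := by exact_mod_cast hm
  have h := aux_stirling n m hn hm
  have hC : ((n + m - 1).choose m : ℝ) * (n.factorial * m.factorial) * (n + m) =
      (n + m).factorial * n := by
    obtain ⟨k, rfl⟩ : ∃ k, n = k + 1 := ⟨n - 1, by omega⟩
    have h1 := Nat.add_choose_mul_factorial_mul_factorial k m
    have e : k + 1 + m - 1 = k + m := by omega
    rw [e]
    have h2 : (k + 1 + m).factorial = (k + m + 1) * (k + m).factorial := by
      rw [show k + 1 + m = (k + m) + 1 by ring, Nat.factorial_succ]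
    rw [Nat.factorial_succ, h2, ← h1]
    have h3 : (k + m).choose k = (k + m).choose m := by
      rw [Nat.choose_symm_add]
    try rw [h3]
    push_cast
    ring
  have hsq : Real.sqrt ((m : ℝ) * n / (n + m)) * (n + m) =
      Real.sqrt ((m : ℝ) * ((n : ℝ) + m) / n) * n := by
    have e1 : ((n : ℝ) + m) = Real.sqrt (((n : ℝ) + m) ^ 2) := (Real.sqrt_sq (by positivity)).symm
    have e2 : (n : ℝ) = Real.sqrt ((n : ℝ) ^ 2) := (Real.sqrt_sq (by positivity)).symm
    have : Real.sqrt ((m : ℝ) * n / (n + m)) * Real.sqrt (((n : ℝ) + m) ^ 2) =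
      Real.sqrt ((m : ℝ) * ((n : ℝ) + m) / n) * Real.sqrt ((n : ℝ) ^ 2) := by
      rw [← Real.sqrt_mul (by positivity), ← Real.sqrt_mul (by positivity)]
      congr 1; field_simp
    rwa [← e1, ← e2] at this
  have e : 1 / (1 - (m : ℝ) / (n + m)) = (n + m) / n := by
    have : 1 - (m : ℝ) / (n + m) = n / (n + m) := by field_simp; ring
    rw [this, one_div_div]
  rw [e, div_pow, div_pow, mul_div_assoc', div_le_div_iff₀ (by positivity) (by positivity)]
  rw [← pow_add]
  have hf : (0 : ℝ) < n.factorial * m.factorial := by positivity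
  refine le_of_mul_le_mul_right ?_ hf
  refine h.trans (le_of_eq ?_)
  refine mul_right_cancel₀ (b := ((n : ℝ) + m)) (by positivity) ?_
  set A := Real.sqrt ((m : ℝ) * n / (n + m))
  set B := Real.sqrt ((m : ℝ) * ((n : ℝ) + m) / n)
  calc _ = 3 * (A * (n + m)) * ((m : ℝ) ^ m * (n : ℝ) ^ n) * (n + m).factorial := by ring
    _ = 3 * B * ((m : ℝ) ^ m * (n : ℝ) ^ n) * ((n + m).factorial * n) := by rw [hsq]; ring
    _ = _ := by rw [← hC]; ring

lemma aux_const {Ω : Type*} [Finite Ω] (g : Equiv.Perm Ω) (κ : Ω → ℕ) (h : κ ∘ ⇑g = κ)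
    {a b : Ω} (hab : g.SameCycle a b) : κ a = κ b := by
  obtain ⟨i, -, -, rfl⟩ := hab.exists_pow_eq'
  induction i with
  | zero => simp
  | succ k ih =>
    rw [pow_succ', Equiv.Perm.mul_apply]
    exact (ih ⟨k, by simp⟩).trans (congrFun h _).symm

open Classical in
lemma aux_fix {Ω : Type*} [Fintype Ω] (g : Equiv.Perm Ω) (m : ℕ) (x : ℝ)
    (hx0 : 0 < x) (hx1 : x < 1) (A : Finset (Ω → ℕ))
    (hA : ∀ κ ∈ A, (∑ ω, κ ω) = m ∧ κ ∘ ⇑g = κ) :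
    (A.card : ℝ) * x ^ m ≤
      ∏ ω, (if g ω = ω then 1 / (1 - x) else 1 / Real.sqrt (1 - x ^ 2)) := by
  let st := Equiv.Perm.SameCycle.setoid g
  let Q := Quotient st
  let c : Q → ℕ := fun q => (univ.filter (fun ω : Ω => (⟦ω⟧ : Q) = q)).card
  have hout : ∀ ω : Ω, g.SameCycle (⟦ω⟧ : Q).out ω := fun ω => Quotient.mk_out (s := st) ω
  have hκ : ∀ κ ∈ A, ∀ ω, κ ω = κ (⟦ω⟧ : Q).out := fun κ h ω =>
    (aux_const g κ (hA κ h).2 (hout ω)).symm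
  have hterm : ∀ κ ∈ A, x ^ m = ∏ q : Q, (x ^ c q) ^ (κ q.out) := by
    intro κ h
    have e : ∀ q : Q, (x ^ c q) ^ (κ q.out) =
        ∏ ω ∈ univ with (⟦ω⟧ : Q) = q, x ^ (κ q.out) := by
      intro q
      rw [prod_const, ← pow_mul, ← pow_mul, mul_comm]
    rw [Finset.prod_congr rfl (fun q _ => e q),
      Finset.prod_fiberwise' univ (fun ω : Ω => (⟦ω⟧ : Q)) (fun q : Q => x ^ (κ q.out)),
      Finset.prod_pow_eq_pow_sum, ← (hA κ h).1]
    congr 1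
    exact Finset.sum_congr rfl fun ω _ => hκ κ h ω
  have hinj : Set.InjOn (fun (κ : Ω → ℕ) (q : Q) => κ q.out) A := by
    intro κ h κ' h' heq
    funext ω
    rw [hκ κ h ω, hκ κ' h' ω]
    exact congrFun heq _
  have hcpos : ∀ q : Q, 1 ≤ c q := by
    intro q
    apply Finset.card_pos.2
    exact ⟨q.out, by simp⟩
  have hstep1 : (A.card : ℝ) * x ^ m ≤ ∏ q : Q, 1 / (1 - x ^ c q) := by
    calc (A.card : ℝ) * x ^ m = ∑ κ ∈ A, ∏ q : Q, (x ^ c q) ^ (κ q.out) := by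
          rw [← nsmul_eq_mul, ← Finset.sum_const]
          exact Finset.sum_congr rfl hterm
      _ = ∑ f ∈ A.image (fun (κ : Ω → ℕ) (q : Q) => κ q.out), ∏ q : Q, (x ^ c q) ^ (f q) := by
          rw [Finset.sum_image hinj]
      _ ≤ ∑ f ∈ Fintype.piFinset (fun _ : Q => Finset.range (m + 1)),
            ∏ q : Q, (x ^ c q) ^ (f q) := by
          apply Finset.sum_le_sum_of_subset_of_nonneg
          · intro f hf
            obtain ⟨κ, h, rfl⟩ := Finset.mem_image.1 hf
            rw [Fintype.mem_piFinset]
            intro q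
            have := Finset.single_le_sum (f := κ) (fun i _ => Nat.zero_le _)
              (Finset.mem_univ (q.out : Ω))
            rw [(hA κ h).1] at this
            simp only [Finset.mem_range]
            omega
          · intros; positivity
      _ = ∏ q : Q, ∑ k ∈ Finset.range (m + 1), (x ^ c q) ^ k := by
          rw [Finset.prod_univ_sum]
      _ ≤ _ := by
          apply Finset.prod_le_prod
          · intros; positivity
          · intro q _
            have h1 : x ^ c q < 1 := pow_lt_one₀ hx0.le hx1 (by have := hcpos q; omega)
            rw [le_div_iff₀ (by linarith), geom_sum_mul_neg]
            have : 0 ≤ (x ^ c q) ^ (m + 1) := by positivity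
            linarith
  refine hstep1.trans ?_
  rw [← Finset.prod_fiberwise univ (fun ω : Ω => (⟦ω⟧ : Q))]
  apply Finset.prod_le_prod
  · intro q _
    have h1 : x ^ c q < 1 := pow_lt_one₀ hx0.le hx1 (by have := hcpos q; omega)
    have : 0 < 1 - x ^ c q := by linarith
    positivity
  intro q _
  have hmem : ∀ ω : Ω, (⟦ω⟧ : Q) = q → g.SameCycle q.out ω := by
    rintro ω rfl
    exact hout ω
  have hmem' : ∀ ω : Ω, g.SameCycle q.out ω → (⟦ω⟧ : Q) = q := by
    intro ω h
    rw [← Quotient.out_eq q]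
    exact Quotient.sound (s := st) h.symm
  by_cases hfix : g q.out = q.out
  · have hs : (univ.filter (fun ω : Ω => (⟦ω⟧ : Q) = q)) = {q.out} := by
      ext ω
      simp only [mem_filter, mem_univ, true_and, mem_singleton]
      constructor
      · intro h
        exact ((hmem ω h).eq_of_left hfix).symm
      · rintro rfl
        simp
    have hc1 : c q = 1 := by simp only [c]; rw [hs]; simp
    rw [hs, hc1]
    simp [hfix]
  · have hnf : ∀ ω ∈ univ.filter (fun ω : Ω => (⟦ω⟧ : Q) = q),
        (if g ω = ω then 1 / (1 - x) else 1 / Real.sqrt (1 - x ^ 2)) =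
          1 / Real.sqrt (1 - x ^ 2) := by
      intro ω h
      rw [mem_filter] at h
      rw [if_neg]
      intro h'
      exact hfix ((hmem ω h.2).apply_eq_self_iff.2 h')
    rw [Finset.prod_congr rfl hnf, prod_const]
    change _ ≤ _ ^ c q
    have hc2 : 2 ≤ c q := by
      have hsub : ({q.out, g q.out} : Finset Ω) ⊆ univ.filter (fun ω : Ω => (⟦ω⟧ : Q) = q) := by
        intro ω h
        simp only [mem_insert, mem_singleton] at h
        simp only [mem_filter, mem_univ, true_and]
        rcases h with rfl | rfl
        · simp
        · exact hmem' _ ⟨1, by simp⟩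
      have := Finset.card_le_card hsub
      rwa [Finset.card_pair (Ne.symm hfix)] at this
    have hx2 : 0 < 1 - x ^ 2 := by nlinarith
    set t := Real.sqrt (1 - x ^ 2) with ht
    have ht0 : 0 < t := Real.sqrt_pos.2 hx2
    have ht2 : t ^ 2 = 1 - x ^ 2 := Real.sq_sqrt hx2.le
    have ht1 : t ≤ 1 := by
      rw [ht, Real.sqrt_le_left (by norm_num), one_pow]
      nlinarith
    rw [one_div_pow]
    apply one_div_le_one_div_of_le (by positivity)
    calc t ^ c q ≤ t ^ 2 := pow_le_pow_of_le_one ht0.le ht1 hc2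
      _ = 1 - x ^ 2 := ht2
      _ ≤ _ := by
        have := pow_le_pow_of_le_one hx0.le hx1.le hc2
        linarith

lemma aux_fix2 {Ω : Type*} [Fintype Ω] [DecidableEq Ω] (n m : ℕ)
    (hn : Fintype.card Ω = n) (hn1 : 1 ≤ n) (hm : 0 < m)
    (g : Equiv.Perm Ω) (A : Finset (Ω → ℕ))
    (hA : ∀ κ ∈ A, (∑ ω, κ ω) = m ∧ κ ∘ ⇑g = κ) :
    (A.card : ℝ) ≤ 3 * Real.sqrt ((m : ℝ) * ((n : ℝ) + m) / n) * ((n + m - 1).choose m : ℝ) *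
      Real.sqrt ((n : ℝ) / ((n : ℝ) + 2 * m)) ^ g.support.card := by
  have hn' : (0 : ℝ) < n := by exact_mod_cast hn1
  have hm' : (0 : ℝ) < m := by exact_mod_cast hm
  set x : ℝ := (m : ℝ) / (n + m) with hx
  have hx0 : 0 < x := by positivity
  have hx1 : x < 1 := by rw [hx, div_lt_one (by positivity)]; linarith
  set ξ := Real.sqrt ((n : ℝ) / ((n : ℝ) + 2 * m)) with hξ
  have h1 := aux_fix g m x hx0 hx1 A hA
  have hw : 1 / Real.sqrt (1 - x ^ 2) = 1 / (1 - x) * ξ := by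
    have hx2 : 0 < 1 - x ^ 2 := by nlinarith
    have e : Real.sqrt (1 - x ^ 2) * ξ = 1 - x := by
      rw [hξ, ← Real.sqrt_mul hx2.le]
      have : (1 - x ^ 2) * ((n : ℝ) / ((n : ℝ) + 2 * m)) = (1 - x) ^ 2 := by
        rw [hx]; field_simp; ring
      rw [this, Real.sqrt_sq (by linarith)]
    have := Real.sqrt_pos.2 hx2
    have h1x : 0 < 1 - x := by linarith
    rw [div_mul_eq_mul_div, one_mul, div_eq_div_iff this.ne' h1x.ne', one_mul, mul_comm, e]
  have h2 : (∏ ω, (if g ω = ω then 1 / (1 - x) else 1 / Real.sqrt (1 - x ^ 2))) =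
      (1 / (1 - x)) ^ n * ξ ^ g.support.card := by
    have : ∀ ω, (if g ω = ω then 1 / (1 - x) else 1 / Real.sqrt (1 - x ^ 2)) =
        1 / (1 - x) * (if ω ∈ g.support then ξ else 1) := by
      intro ω
      by_cases h : g ω = ω <;> simp only [h, Equiv.Perm.mem_support, if_true, if_false, ne_eq,
        not_true, not_false_iff, mul_one, hw]
    rw [Finset.prod_congr rfl (fun ω _ => this ω), Finset.prod_mul_distrib, prod_const,
      Finset.prod_ite_mem, prod_const, Finset.card_univ, hn, Finset.univ_inter]
  have h3 := aux_binom n m hn1 hm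
  rw [← hx] at h3
  have h1' : (A.card : ℝ) * x ^ m ≤ (1 / (1 - x)) ^ n * ξ ^ g.support.card := by
    rw [← h2]
    convert h1
  refine le_of_mul_le_mul_right ?_ (pow_pos hx0 m)
  calc _ ≤ _ := h1'
    _ ≤ (3 * Real.sqrt ((m : ℝ) * ((n : ℝ) + m) / n) * ((n + m - 1).choose m : ℝ) * x ^ m) *
        ξ ^ g.support.card := by gcongr
    _ = _ := by ring

/-- Theorem 4.1, inequality (26): for a nontrivial permutation group `G` on a set of size
`n ≥ 1` with minimal degree `μ`, and `m > 0`, the average stabilizer size of the action of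
`G` on multisets of size `m` (multiplicity functions `κ : Ω → ℕ` with sum `m`) satisfies
`(⟨Stab⟩_{(m)} - 1)/|G| < 3 √(m(n+m)/n) · ξ₂ ^ μ`, where `ξ₂ = √(n/(n+2m))`.
The average stabilizer size is expressed via the count of passive pairs `(g, κ)`
divided by the number of multisets of size `m`. -/
theorem stmt_10 {Ω : Type*} [Fintype Ω] [DecidableEq Ω] (n m : ℕ)
    (hn : Fintype.card Ω = n) (hn1 : 1 ≤ n) (hm : 0 < m)
    (G : Subgroup (Equiv.Perm Ω)) (hG : G ≠ ⊥) (μ : ℕ)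
    (hμ : μ = sInf {k : ℕ | ∃ g ∈ G, g ≠ 1 ∧ (Equiv.Perm.support g).card = k}) :
    (({p : Equiv.Perm Ω × (Ω → ℕ) |
          p.1 ∈ G ∧ (∑ ω, p.2 ω) = m ∧ p.2 ∘ ⇑p.1 = p.2}.ncard : ℝ) /
        ({κ : Ω → ℕ | (∑ ω, κ ω) = m}.ncard : ℝ) - 1) / (Nat.card G : ℝ) <
      3 * Real.sqrt ((m : ℝ) * ((n : ℝ) + m) / n) *
        Real.sqrt ((n : ℝ) / ((n : ℝ) + 2 * m)) ^ μ := by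
  classical
  have hn' : (0 : ℝ) < n := by exact_mod_cast hn1
  have hm' : (0 : ℝ) < m := by exact_mod_cast hm
  set M : Finset (Ω → ℕ) := Finset.piAntidiag univ m with hM
  have hMm : ∀ κ, κ ∈ M ↔ (∑ ω, κ ω) = m := by intro κ; simp [hM]
  have hMset : {κ : Ω → ℕ | (∑ ω, κ ω) = m} = (M : Set (Ω → ℕ)) := by
    ext κ; simp [hMm]
  have hMcard : M.card = (n + m - 1).choose m := by
    have h1 : Nat.card {P : Ω → ℕ // ∑ i, P i = m} = M.card := by
      change Nat.card ({κ : Ω → ℕ | (∑ ω, κ ω) = m} : Set (Ω → ℕ)) = _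
      rw [hMset]; simp
    rw [← h1, ← Nat.card_congr (Sym.equivNatSumOfFintype Ω m), Nat.card_eq_fintype_card,
      Sym.card_sym_eq_choose, hn]
  have hNpos : (0 : ℝ) < M.card := by
    rw [hMcard]; exact_mod_cast Nat.choose_pos (by omega)
  set GG : Finset (Equiv.Perm Ω) := univ.filter (· ∈ G) with hGG
  have hGcard : Nat.card G = GG.card := by
    rw [hGG, Nat.card_eq_fintype_card, Fintype.card_subtype]
  have hP : {p : Equiv.Perm Ω × (Ω → ℕ) |
          p.1 ∈ G ∧ (∑ ω, p.2 ω) = m ∧ p.2 ∘ ⇑p.1 = p.2} =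
      ((GG ×ˢ M).filter (fun p : Equiv.Perm Ω × (Ω → ℕ) => p.2 ∘ ⇑p.1 = p.2) : Finset _) := by
    ext p
    simp [hGG, hMm, and_assoc]
  have hPcard : ((GG ×ˢ M).filter (fun p : Equiv.Perm Ω × (Ω → ℕ) => p.2 ∘ ⇑p.1 = p.2)).card =
      ∑ g ∈ GG, (M.filter (fun κ => κ ∘ ⇑g = κ)).card := by
    rw [Finset.card_filter, Finset.sum_product]
    exact Finset.sum_congr rfl fun g _ => (Finset.card_filter _ _).symm
  rw [hP, hMset, Set.ncard_coe_finset, Set.ncard_coe_finset, hPcard, hGcard]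
  have h1G : (1 : Equiv.Perm Ω) ∈ GG := by simp [hGG, G.one_mem]
  have hGpos : (0 : ℝ) < GG.card := by
    exact_mod_cast Finset.card_pos.2 ⟨1, h1G⟩
  set ξ := Real.sqrt ((n : ℝ) / ((n : ℝ) + 2 * m)) with hξ
  set K := 3 * Real.sqrt ((m : ℝ) * ((n : ℝ) + m) / n) with hK
  have hKpos : 0 < K := by positivity
  have hξpos : 0 < ξ := by positivity
  have hξ1 : ξ ≤ 1 := by
    rw [hξ, Real.sqrt_le_left (by norm_num), one_pow, div_le_one (by positivity)]; linarith
  rw [← Finset.add_sum_erase _ _ h1G]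
  have hone : (M.filter (fun κ => κ ∘ ⇑(1 : Equiv.Perm Ω) = κ)).card = M.card := by
    congr 1
    apply Finset.filter_true_of_mem
    intro κ _
    rfl
  rw [hone]
  push_cast
  rw [add_div, div_self hNpos.ne', add_sub_cancel_left, div_div, div_lt_iff₀ (by positivity)]
  calc (∑ g ∈ GG.erase 1, ((M.filter (fun κ => κ ∘ ⇑g = κ)).card : ℝ))
      ≤ ∑ g ∈ GG.erase 1, K * M.card * ξ ^ μ := by
        apply Finset.sum_le_sum
        intro g hg
        rw [Finset.mem_erase, hGG, Finset.mem_filter] at hg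
        have hb := aux_fix2 n m hn hn1 hm g (M.filter (fun κ => κ ∘ ⇑g = κ))
          (fun κ hκ => ⟨(hMm κ).1 (Finset.mem_filter.1 hκ).1, (Finset.mem_filter.1 hκ).2⟩)
        rw [← hMcard] at hb
        refine hb.trans ?_
        have hμle : μ ≤ g.support.card := by
          rw [hμ]
          exact Nat.sInf_le ⟨g, hg.2.2, hg.1, rfl⟩
        have := pow_le_pow_of_le_one hξpos.le hξ1 hμle
        gcongr
    _ = ((GG.card : ℝ) - 1) * (K * M.card * ξ ^ μ) := by
        rw [Finset.sum_const, nsmul_eq_mul, Finset.card_erase_of_mem h1G,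
          Nat.cast_sub (Finset.card_pos.2 ⟨1, h1G⟩)]
        simp
    _ < GG.card * (K * M.card * ξ ^ μ) := by
        apply mul_lt_mul_of_pos_right (by linarith) (by positivity)
    _ = _ := by ring
end

section
/- For every real c > 1/2 and every ε > 0, the set of pairs of positive integers (m, n) with 0 < m < n satisfying min(m, n−m) > c·√n·ln n and for which √(m(n−m)/n) · (√(1 − 2·(m/n)·(1−m/n)))^{√n/2} ≥ ε, is finite. -/
theorem stmt_11_aux (c ε : ℝ) (hc : 1 / 2 < c) (hε : 0 < ε) (m n : ℝ) (hm : 0 < m) (hmn : m < n)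
    (hK : min m (n - m) > c * Real.sqrt n * Real.log n)
    (hE : ε ≤ Real.sqrt (m * (n - m) / n) *
          Real.sqrt (1 - 2 * (m / n) * (1 - m / n)) ^ (Real.sqrt n / 2))
    (h1 : c ^ 2 * (Real.log n ^ 2 / n ^ (1 / 2 : ℝ)) < 1) :
    ε ^ 2 ≤ (2 * c / (c - 1 / 2) * Real.exp 1) * n ^ (-(c / 2 - 1 / 4)) := by
  have hn : 0 < n := hm.trans hmn
  rw [← Real.sqrt_eq_rpow] at h1
  obtain ⟨hK1, hK2⟩ := lt_min_iff.1 hK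
  have hs : 0 < Real.sqrt n := Real.sqrt_pos.2 hn
  have hss : Real.sqrt n ^ 2 = n := Real.sq_sqrt hn.le
  have hexp : Real.sqrt n = Real.exp (Real.log n / 2) := by
    rw [← Real.log_sqrt hn.le, Real.exp_log hs]
  have hpow : n ^ (-(c / 2 - 1 / 4)) = Real.exp (Real.log n * (-(c / 2 - 1 / 4))) :=
    Real.rpow_def_of_pos hn _
  rw [hpow]
  set s := Real.sqrt n with hsdef
  set l := Real.log n with hldef
  obtain ⟨y, hy⟩ : ∃ y, y = m * (n - m) / n / s := ⟨_, rfl⟩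
  have hx : m * (n - m) / n = y * s := by rw [hy]; field_simp
  have hy0 : 0 < y := by
    rw [hy]; have : 0 < n - m := by linarith
    positivity
  have hu : (m / n) * (1 - m / n) = y / s := by
    rw [hy]; field_simp; rw [hss]; ring
  have hyL : c * l - 1 ≤ y := by
    have h2 : 0 ≤ (m - c * s * l) * (n - m - c * s * l) :=
      mul_nonneg (by linarith) (by linarith)
    have h3 : m * (n - m) = y * s * n := by rw [← hx]; field_simp
    have h4 : c ^ 2 * l ^ 2 < s := by
      rw [← mul_div_assoc, div_lt_one hs] at h1; exact h1
    have h5 : 0 ≤ s * s^2 * (y - c * l) + s ^ 2 * (c ^ 2 * l ^ 2) := by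
      rw [← hss] at h2 h3
      nlinarith
    have h6 : 0 ≤ s * (y - c * l) + c ^ 2 * l ^ 2 := by
      by_contra h
      push Not at h
      have := mul_neg_of_pos_of_neg (pow_pos hs 2) h
      nlinarith
    by_contra h
    push Not at h
    have := mul_lt_mul_of_pos_left h hs
    nlinarith
  have hxi : Real.sqrt (1 - 2 * (m / n) * (1 - m / n)) ^ (s / 2) ≤ Real.exp (-y / 2) := by
    have e1 : 1 - 2 * (m / n) * (1 - m / n) = 1 - 2 * (y / s) := by rw [← hu]; ring
    rw [e1]
    have e2 : Real.sqrt (1 - 2 * (y / s)) ≤ Real.exp (-(y / s)) := by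
      rw [Real.sqrt_le_left (Real.exp_pos _).le, ← Real.exp_nat_mul]
      have := Real.add_one_le_exp ((2 : ℕ) * -(y / s))
      push_cast at *
      linarith
    refine (Real.rpow_le_rpow (Real.sqrt_nonneg _) e2 (by positivity)).trans (le_of_eq ?_)
    rw [← Real.exp_mul]
    congr 1
    field_simp
  rw [hx] at hE
  have hE2 : ε ≤ Real.sqrt (y * s) * Real.exp (-y / 2) :=
    hE.trans (mul_le_mul_of_nonneg_left hxi (Real.sqrt_nonneg _))
  have hE3 : ε ^ 2 ≤ y * s * Real.exp (-y) := by
    refine (pow_le_pow_left₀ hε.le hE2 2).trans (le_of_eq ?_)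
    rw [mul_pow, Real.sq_sqrt (by positivity), ← Real.exp_nat_mul]
    congr 2
    push_cast; ring
  refine hE3.trans ?_
  have hc2 : 0 < c - 1 / 2 := by linarith
  have hc0 : 0 < c := by linarith
  obtain ⟨θ, hθ⟩ : ∃ θ, θ = (c - 1 / 2) / (2 * c) := ⟨_, rfl⟩
  have hθ0 : 0 < θ := by rw [hθ]; positivity
  have hθc : θ * c = (c - 1 / 2) / 2 := by rw [hθ]; field_simp
  have hθi : 2 * c / (c - 1 / 2) = θ⁻¹ := by rw [hθ, inv_div]
  have hθ1 : θ < 1 := by rw [hθ, div_lt_one (by positivity)]; linarith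
  rw [hθi]
  have h7 : y ≤ θ⁻¹ * Real.exp (θ * y) := by
    have := Real.add_one_le_exp (θ * y)
    rw [inv_mul_eq_div, le_div_iff₀ hθ0]; linarith
  calc y * s * Real.exp (-y) ≤ θ⁻¹ * Real.exp (θ * y) * s * Real.exp (-y) := by gcongr
    _ = θ⁻¹ * Real.exp (θ * y + l / 2 + -y) := by
        rw [hexp, Real.exp_add, Real.exp_add]; ring
    _ ≤ θ⁻¹ * Real.exp (1 + l * (-(c / 2 - 1 / 4))) := by
        refine mul_le_mul_of_nonneg_left (Real.exp_le_exp.2 ?_) (by positivity)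
        have := mul_le_mul_of_nonneg_left hyL (by linarith : 0 ≤ 1 - θ)
        have h8 : θ * c * l = (c - 1 / 2) / 2 * l := by rw [hθc]
        nlinarith
    _ = _ := by rw [Real.exp_add]; ring

/-- Proposition 4.2(a): for every `c > 1/2` and `ε > 0`, there are only finitely many
pairs of positive integers `(m, n)` with `0 < m < n`, `min(m, n-m) > c √n ln n`, for which
`√(m(n-m)/n) · (ξ₁(m/n)) ^ (√n / 2) ≥ ε`, where `ξ₁(λ) = √(1 - 2λ(1-λ))`. -/
theorem stmt_11 (c ε : ℝ) (hc : 1 / 2 < c) (hε : 0 < ε) :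
    {p : ℕ × ℕ | 0 < p.1 ∧ p.1 < p.2 ∧
        min (p.1 : ℝ) ((p.2 : ℝ) - p.1) > c * Real.sqrt p.2 * Real.log p.2 ∧
        ε ≤ Real.sqrt ((p.1 : ℝ) * ((p.2 : ℝ) - p.1) / p.2) *
          Real.sqrt (1 - 2 * ((p.1 : ℝ) / p.2) * (1 - (p.1 : ℝ) / p.2)) ^
            (Real.sqrt p.2 / 2)}.Finite := by
  have t1 : Filter.Tendsto (fun n : ℝ => c ^ 2 * (Real.log n ^ 2 / n ^ (1 / 2 : ℝ)))
      Filter.atTop (nhds 0) := by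
    have h := (isLittleO_log_rpow_rpow_atTop 2 (by norm_num : (0 : ℝ) < 1 / 2)).tendsto_div_nhds_zero
    simpa using h.const_mul (c ^ 2)
  have t2 : Filter.Tendsto (fun n : ℝ =>
      (2 * c / (c - 1 / 2) * Real.exp 1) * n ^ (-(c / 2 - 1 / 4))) Filter.atTop (nhds 0) := by
    have h := tendsto_rpow_neg_atTop (by linarith : 0 < c / 2 - 1 / 4)
    simpa using h.const_mul (2 * c / (c - 1 / 2) * Real.exp 1)
  have ev := (t1.eventually (gt_mem_nhds one_pos)).and
    (t2.eventually (gt_mem_nhds (pow_pos hε 2)))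
  obtain ⟨N, hN⟩ := Filter.eventually_atTop.1 (tendsto_natCast_atTop_atTop.eventually ev)
  refine ((Set.finite_Iio N).prod (Set.finite_Iio N)).subset ?_
  rintro ⟨m, n⟩ ⟨h0, hmn, hK, hE⟩
  have hlt : n < N := by
    by_contra h
    obtain ⟨a, b⟩ := hN n (not_lt.1 h)
    exact absurd (stmt_11_aux c ε hc hε m n (by exact_mod_cast h0) (by exact_mod_cast hmn) hK hE a)
      (not_le.2 b)
  exact ⟨hmn.trans hlt, hlt⟩
end

section
/- For every real c > 1/2 and every ε > 0, the set of pairs of positive integers (m, n) with m > c·√n·ln n and n > 16 for which √(m(n+m)/n) · (√(n/(n+2m)))^{√n/2} ≥ ε, is finite. -/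
open Filter Topology in
/-- The key estimate on the square of the quantity. -/
lemma key_bound (k : ℝ) (hk : k < 1) (m n : ℕ) (hm : 0 < m) (hn : 16 < n) :
    (Real.sqrt ((m : ℝ) * ((n : ℝ) + m) / n) *
          Real.sqrt ((n : ℝ) / ((n : ℝ) + 2 * m)) ^ (Real.sqrt n / 2)) ^ 2
      ≤ n / (2 * (1 - k) * (Real.sqrt n / 2 - 2)) *
        Real.exp (-(k * (Real.sqrt n / 2 - 2) * Real.log (1 + 2 * m / n))) := by
  have hn' : (16 : ℝ) < n := by exact_mod_cast hn
  have hm' : (0 : ℝ) < m := by exact_mod_cast hm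
  have hn0 : (0 : ℝ) < n := by linarith
  have hs : 4 < Real.sqrt n := by
    apply Real.lt_sqrt_of_sq_lt; norm_num; exact_mod_cast hn
  set s := Real.sqrt n with hsdef
  have ha : 0 < s / 2 - 2 := by linarith
  have hb : 0 < 1 - k := by linarith
  have h1 : 0 < 1 + 2 * (m : ℝ) / n := by positivity
  set L := Real.log (1 + 2 * m / n) with hL
  have hexp : Real.exp L = 1 + 2 * m / n := Real.exp_log h1
  have hL0 : 0 ≤ L := Real.log_nonneg (by
    have : 0 ≤ 2 * (m : ℝ) / n := by positivity
    linarith)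
  have hy : (n : ℝ) / (n + 2 * m) = Real.exp (-L) := by
    rw [Real.exp_neg, hexp]; field_simp
  have hsq : Real.sqrt ((n : ℝ) / (n + 2 * m)) = Real.exp (-L / 2) := by
    rw [hy, Real.exp_half]
  have hx : (m : ℝ) * (n + m) / n = n * (Real.exp (2 * L) - 1) / 4 := by
    rw [two_mul, Real.exp_add, hexp]; field_simp; ring
  have hx0 : 0 ≤ (m : ℝ) * (n + m) / n := by positivity
  rw [mul_pow, Real.sq_sqrt hx0, hsq, ← Real.exp_mul, ← Real.exp_nat_mul, hx]
  have e1 : Real.exp (2 * L) - 1 ≤ 2 * L * Real.exp (2 * L) := by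
    have := Real.add_one_le_exp (-(2 * L))
    have h2 : Real.exp (-(2 * L)) * Real.exp (2 * L) = 1 := by
      rw [← Real.exp_add]; simp
    nlinarith [Real.exp_pos (2 * L)]
  have e2 : L * ((1 - k) * (s / 2 - 2)) ≤ Real.exp ((1 - k) * (s / 2 - 2) * L) := by
    have := Real.add_one_le_exp ((1 - k) * (s / 2 - 2) * L)
    linarith
  have e2' : L ≤ Real.exp ((1 - k) * (s / 2 - 2) * L) / ((1 - k) * (s / 2 - 2)) := by
    rw [le_div_iff₀ (by positivity)]; exact e2
  calc _ ≤ n * (2 * L * Real.exp (2 * L)) / 4 * Real.exp (((2 : ℕ) : ℝ) * (-L / 2 * (s / 2))) := by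
        gcongr
    _ = n / 2 * L * Real.exp (2 * L + ((2 : ℕ) : ℝ) * (-L / 2 * (s / 2))) := by
        rw [Real.exp_add]; ring
    _ ≤ n / 2 * (Real.exp ((1 - k) * (s / 2 - 2) * L) / ((1 - k) * (s / 2 - 2))) *
        Real.exp (2 * L + ((2 : ℕ) : ℝ) * (-L / 2 * (s / 2))) := by
        gcongr
    _ = n / (2 * (1 - k) * (s / 2 - 2)) * (Real.exp ((1 - k) * (s / 2 - 2) * L) *
        Real.exp (2 * L + ((2 : ℕ) : ℝ) * (-L / 2 * (s / 2)))) := by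
        field_simp
    _ = _ := by
        rw [← Real.exp_add]; congr 2; push_cast; ring

/-- A lower bound for the logarithm. -/
lemma log_lower (x : ℝ) (hx : 0 ≤ x) : 2 * x / (1 + x) ≤ Real.log (1 + 2 * x) := by
  have := Real.le_log_one_add_of_nonneg (x := 2 * x) (by linarith)
  calc _ = 2 * (2 * x) / (2 * x + 2) := by field_simp; ring
    _ ≤ _ := this

open Filter Topology in
lemma tendsto_log_div_sqrt :
    Tendsto (fun n : ℕ => Real.log n / Real.sqrt n) atTop (𝓝 0) := by
  have h := (isLittleO_log_rpow_atTop (r := 1 / 2) (by norm_num)).tendsto_div_nhds_zero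
  have := h.comp (tendsto_natCast_atTop_atTop (R := ℝ))
  simpa [Function.comp_def, Real.sqrt_eq_rpow] using this

open Filter Topology in
lemma tendsto_sqrt_nat : Tendsto (fun n : ℕ => Real.sqrt n) atTop atTop :=
  Real.tendsto_sqrt_atTop.comp tendsto_natCast_atTop_atTop

open Filter Topology in
/-- Uniform smallness for large `n`. -/
lemma large_n (c ε : ℝ) (hc : 1 / 2 < c) (hε : 0 < ε) :
    ∃ N : ℕ, ∀ n ≥ N, ∀ m : ℕ, 0 < m → 16 < n →
      (m : ℝ) > c * Real.sqrt n * Real.log n →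
      Real.sqrt ((m : ℝ) * ((n : ℝ) + m) / n) *
          Real.sqrt ((n : ℝ) / ((n : ℝ) + 2 * m)) ^ (Real.sqrt n / 2) < ε := by
  obtain ⟨k, hk1, hk2⟩ : ∃ k, 1 / 2 / c < k ∧ k < 1 :=
    exists_between (by rw [div_lt_one (by linarith)]; exact hc)
  have hkc : 1 / 2 < k * c := by rwa [div_lt_iff₀ (by linarith)] at hk1
  obtain ⟨d, hd1, hd2⟩ := exists_between hkc
  have hk0 : 0 < k := lt_trans (by have : 0 < c := by linarith
                                   positivity) hk1
  have hlim : Tendsto (fun n : ℕ => k * c * (1 - 4 / Real.sqrt n) /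
      (1 + c * (Real.log n / Real.sqrt n))) atTop (𝓝 (k * c * (1 - 0) / (1 + c * 0))) := by
    apply Tendsto.div
    · exact (tendsto_const_nhds.sub (tendsto_const_nhds.div_atTop tendsto_sqrt_nat)).const_mul _
    · exact tendsto_const_nhds.add (tendsto_log_div_sqrt.const_mul _)
    · norm_num
  have ev1 := hlim.eventually_const_lt (u := d) (by simpa using hd2)
  have hlim2 : Tendsto (fun n : ℕ => (2 / (1 - k)) * (n : ℝ) ^ (-(d - 1 / 2))) atTop
      (𝓝 ((2 / (1 - k)) * 0)) :=
    ((tendsto_rpow_neg_atTop (by linarith)).comp tendsto_natCast_atTop_atTop).const_mul _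
  have ev2 := hlim2.eventually_lt_const (u := ε ^ 2) (by simpa using by positivity)
  have ev3 := tendsto_sqrt_nat.eventually_ge_atTop 8
  obtain ⟨N, hN⟩ := eventually_atTop.1 (ev1.and (ev2.and ev3))
  refine ⟨N, fun n hn m hm hn16 hmn => ?_⟩
  obtain ⟨h1, h2, h3⟩ := hN n hn
  apply lt_of_pow_lt_pow_left₀ 2 hε.le
  refine lt_of_le_of_lt (key_bound k hk2 m n hm hn16) (lt_of_le_of_lt ?_ h2)
  have hn' : (16 : ℝ) < n := by exact_mod_cast hn16
  have hn0 : (0 : ℝ) < n := by linarith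
  have hss : Real.sqrt n * Real.sqrt n = n := Real.mul_self_sqrt hn0.le
  have hl0 : 0 < Real.log n := Real.log_pos (by linarith)
  have hr : (n : ℝ) ^ (-(d - 1 / 2)) = Real.sqrt n * Real.exp (-(d * Real.log n)) := by
    rw [Real.sqrt_eq_rpow, Real.rpow_def_of_pos hn0, Real.rpow_def_of_pos hn0, ← Real.exp_add]
    congr 1; ring
  rw [hr]
  set s := Real.sqrt n with hs
  set l := Real.log n with hl
  have hs0 : 0 < s := by linarith
  have hk' : 0 < 1 - k := by linarith
  have hc0 : 0 < c := by linarith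
  have hlow : 2 * (c * (l / s)) / (1 + c * (l / s)) ≤ Real.log (1 + 2 * m / n) := by
    refine (log_lower _ (by positivity)).trans ?_
    apply Real.log_le_log (by positivity)
    have : c * (l / s) ≤ m / n := by
      rw [le_div_iff₀ hn0, ← hss]
      calc _ = c * s * l := by field_simp
        _ ≤ _ := hmn.le
    rw [mul_div_assoc]; linarith
  have hexpo : d * l ≤ k * (s / 2 - 2) * Real.log (1 + 2 * m / n) := by
    calc d * l ≤ (k * c * (1 - 4 / s) / (1 + c * (l / s))) * l := by gcongr
      _ = k * (s / 2 - 2) * (2 * (c * (l / s)) / (1 + c * (l / s))) := by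
        have : 0 < 1 + c * (l / s) := by positivity
        have : 0 < s + c * l := by positivity
        field_simp
        ring
      _ ≤ _ := by
        have : 0 ≤ k * (s / 2 - 2) := mul_nonneg hk0.le (by linarith)
        gcongr
  have hcoef : n / (2 * (1 - k) * (s / 2 - 2)) ≤ 2 / (1 - k) * s := by
    have : 0 < s / 2 - 2 := by linarith
    rw [div_le_iff₀ (by positivity), ← hss]
    have : 2 / (1 - k) * s * (2 * (1 - k) * (s / 2 - 2)) = 4 * s * (s / 2 - 2) := by
      field_simp; ring
    rw [this]; nlinarith
  calc _ ≤ 2 / (1 - k) * s * Real.exp (-(d * l)) := by gcongr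
    _ = _ := by ring

open Filter Topology in
/-- Smallness for fixed `n` and large `m`. -/
lemma fixed_n (ε : ℝ) (hε : 0 < ε) (n : ℕ) :
    ∃ M : ℕ, ∀ m ≥ M, 0 < m → 16 < n →
      Real.sqrt ((m : ℝ) * ((n : ℝ) + m) / n) *
          Real.sqrt ((n : ℝ) / ((n : ℝ) + 2 * m)) ^ (Real.sqrt n / 2) < ε := by
  by_cases hn : 16 < n
  swap
  · exact ⟨0, fun m _ _ h => absurd h hn⟩
  have hn' : (16 : ℝ) < n := by exact_mod_cast hn
  have hn0 : (0 : ℝ) < n := by linarith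
  have hs : 4 < Real.sqrt n := by
    apply Real.lt_sqrt_of_sq_lt; norm_num; exact_mod_cast hn
  have ha : 0 < (1 / 2) * (Real.sqrt n / 2 - 2) := by linarith
  have t1 : Tendsto (fun m : ℕ => 1 + 2 * (m : ℝ) / n) atTop atTop :=
    tendsto_atTop_add_const_left _ _
      ((tendsto_natCast_atTop_atTop.const_mul_atTop (by norm_num)).atTop_div_const hn0)
  have t2 := Real.tendsto_exp_neg_atTop_nhds_zero.comp
    ((Real.tendsto_log_atTop.comp t1).const_mul_atTop ha)
  have t3 := t2.const_mul (n / (2 * (1 - 1 / 2) * (Real.sqrt n / 2 - 2)))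
  have ev := t3.eventually_lt_const (u := ε ^ 2) (by simpa using by positivity)
  obtain ⟨M, hM⟩ := eventually_atTop.1 ev
  refine ⟨M, fun m hm hm0 _ => ?_⟩
  apply lt_of_pow_lt_pow_left₀ 2 hε.le
  exact lt_of_le_of_lt (key_bound (1 / 2) (by norm_num) m n hm0 hn) (hM m hm)

/-- Proposition 4.2(b): for every `c > 1/2` and `ε > 0`, there are only finitely many
pairs of positive integers `(m, n)` with `m > c √n ln n` and `n > 16` for which
`√(m(n+m)/n) · (√(n/(n+2m))) ^ (√n / 2) ≥ ε`. -/
theorem stmt_12 (c ε : ℝ) (hc : 1 / 2 < c) (hε : 0 < ε) :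
    {p : ℕ × ℕ | 0 < p.1 ∧ 16 < p.2 ∧
        (p.1 : ℝ) > c * Real.sqrt p.2 * Real.log p.2 ∧
        ε ≤ Real.sqrt ((p.1 : ℝ) * ((p.2 : ℝ) + p.1) / p.2) *
          Real.sqrt ((p.2 : ℝ) / ((p.2 : ℝ) + 2 * p.1)) ^
            (Real.sqrt p.2 / 2)}.Finite := by
  obtain ⟨N, hN⟩ := large_n c ε hc hε
  choose M hM using fixed_n ε hε
  refine ((Set.finite_Iio N).biUnion
    (fun n _ => (Set.finite_Iio (M n)).prod (Set.finite_singleton n))).subset ?_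
  rintro ⟨m, n⟩ ⟨h1, h2, h3, h4⟩
  have hn : n < N := by
    by_contra h
    exact absurd h4 (not_le.2 (hN n (not_lt.1 h) m h1 h2 h3))
  have hm : m < M n := by
    by_contra h
    exact absurd h4 (not_le.2 (hM n m (not_lt.1 h) h1 h2))
  simp only [Set.mem_iUnion]
  exact ⟨n, hn, hm, rfl⟩
end

section
/- Let G be a nontrivial subgroup of the symmetric group of a finite set Ω with |Ω| = n, with minimal degree μ = min_{g∈G, g≠e} β(g). Let B be a subset of G containing the identity with B ≠ G, and let μ* = min_{g∈G∖B} β(g). Then for the natural action of G on m-element subsets of Ω with 0 < m < n, the average stabilizer size satisfies ⟨Stab⟩_m − 1 < 3·√(m(n−m)/n) · (|G|·ξ₁^{μ*} + |B|·ξ₁^{μ}), where ξ₁ = √(m² + (n−m)²)/n. -/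
open Finset

theorem cyc_bound {p q ξ : ℝ} (hp : 0 ≤ p) (hq : 0 ≤ q) (hξ : 0 ≤ ξ) (h : ξ ^ 2 = p ^ 2 + q ^ 2)
    (c : ℕ) (hc : 2 ≤ c) : p ^ c + q ^ c ≤ ξ ^ c := by
  obtain ⟨k, rfl⟩ := Nat.exists_eq_add_of_le hc
  have h1 : p ≤ ξ := abs_le_of_sq_le_sq' (by nlinarith [sq_nonneg q]) hξ |>.2
  have h2 : q ≤ ξ := abs_le_of_sq_le_sq' (by nlinarith [sq_nonneg p]) hξ |>.2
  have h3 := pow_le_pow_left₀ hp h1 k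
  have h4 := pow_le_pow_left₀ hq h2 k
  rw [pow_add, pow_add, pow_add, h, add_mul]
  gcongr

theorem inv_bound {Ω : Type*} [Fintype Ω] [DecidableEq Ω] (g : Equiv.Perm Ω) {p q ξ : ℝ}
    (hp : 0 ≤ p) (hq : 0 ≤ q) (hξ : 0 ≤ ξ) (hpq : p + q = 1) (h : ξ ^ 2 = p ^ 2 + q ^ 2) (N : ℕ) :
    ∀ S : Finset Ω, S.card = N → (∀ y, g y ∈ S ↔ y ∈ S) →
      ∑ x ∈ S.powerset with (∀ y, g y ∈ x ↔ y ∈ x), p ^ x.card * q ^ (S.card - x.card)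
        ≤ ξ ^ (S ∩ g.support).card := by
  induction N using Nat.strong_induction_on with
  | _ N ih =>
  intro S hSN hS
  rcases S.eq_empty_or_nonempty with rfl | ⟨a, ha⟩
  · simp [Finset.sum_filter]
  classical
  set C : Finset Ω := univ.filter (fun b => g.SameCycle a b) with hC
  have haC : a ∈ C := mem_filter.2 ⟨mem_univ _, Equiv.Perm.SameCycle.refl _ _⟩
  have hCg : ∀ y, g y ∈ C ↔ y ∈ C := by intro y; simp [hC]
  have key : ∀ x : Finset Ω, (∀ y, g y ∈ x ↔ y ∈ x) → ∀ b ∈ C, (b ∈ x ↔ a ∈ x) := by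
    intro x hx b hb
    obtain ⟨i, hi⟩ := (mem_filter.1 hb).2
    have hz : ∀ (i : ℤ) (y), (g ^ i) y ∈ x ↔ y ∈ x := by
      intro i
      induction i using Int.induction_on with
      | zero => simp
      | succ i hi => intro y; rw [zpow_add_one, Equiv.Perm.mul_apply, hi, hx]
      | pred i hi =>
        intro y; rw [zpow_sub_one, Equiv.Perm.mul_apply, hi, ← hx]; simp
    rw [← hi, hz]
  have hCS : C ⊆ S := fun b hb => (key S hS b hb).2 ha
  set S' := S \ C with hS'
  have hcard : S'.card + C.card = S.card := card_sdiff_add_card_eq_card hCS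
  have hCpos : 0 < C.card := card_pos.2 ⟨a, haC⟩
  have hS'g : ∀ y, g y ∈ S' ↔ y ∈ S' := by intro y; simp only [hS', mem_sdiff, hS, hCg]
  have IH := ih S'.card (by omega) S' rfl hS'g
  set T' := S'.powerset.filter (fun x => ∀ y, g y ∈ x ↔ y ∈ x) with hT'
  set T := S.powerset.filter (fun x => ∀ y, g y ∈ x ↔ y ∈ x) with hT
  have nn : ∀ i j : ℕ, 0 ≤ p ^ i * q ^ j := fun i j => by positivity
  have e1 : ∑ x ∈ T with a ∉ x, p ^ x.card * q ^ (S.card - x.card)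
      ≤ q ^ C.card * ∑ x ∈ T', p ^ x.card * q ^ (S'.card - x.card) := by
    rw [mul_sum]
    calc _ ≤ ∑ x ∈ T', p ^ x.card * q ^ (S.card - x.card) := by
          apply sum_le_sum_of_subset_of_nonneg
          · intro x hx
            simp only [hT, hT', mem_filter, mem_powerset] at hx ⊢
            refine ⟨fun b hb => ?_, hx.1.2⟩
            refine mem_sdiff.2 ⟨hx.1.1 hb, fun hbC => hx.2 ((key x hx.1.2 b hbC).1 hb)⟩
          · intros; apply nn
      _ ≤ _ := by
          apply le_of_eq
          apply sum_congr rfl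
          intro x hx
          have := card_le_card (mem_powerset.1 (mem_filter.1 hx).1)
          rw [show S.card - x.card = C.card + (S'.card - x.card) by omega, pow_add]; ring
  have e2 : ∑ x ∈ T with a ∈ x, p ^ x.card * q ^ (S.card - x.card)
      ≤ p ^ C.card * ∑ x ∈ T', p ^ x.card * q ^ (S'.card - x.card) := by
    rw [mul_sum]
    have hdis : ∀ x ∈ T', Disjoint x C := by
      intro x hx
      exact disjoint_of_subset_left (mem_powerset.1 (mem_filter.1 hx).1) sdiff_disjoint
    calc _ ≤ ∑ x ∈ T'.image (· ∪ C), p ^ x.card * q ^ (S.card - x.card) := by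
          apply sum_le_sum_of_subset_of_nonneg
          · intro x hx
            simp only [hT, hT', mem_filter, mem_powerset, mem_image] at hx ⊢
            refine ⟨x \ C, ⟨sdiff_subset_sdiff hx.1.1 subset_rfl, ?_⟩, ?_⟩
            · intro y; simp only [mem_sdiff, hCg, hx.1.2]
            · exact sdiff_union_of_subset (fun b hb => (key x hx.1.2 b hb).2 hx.2)
          · intros; apply nn
      _ = _ := by
          rw [sum_image]
          · apply sum_congr rfl
            intro x hx
            have := card_le_card (mem_powerset.1 (mem_filter.1 hx).1)
            rw [card_union_of_disjoint (hdis x hx),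
              show S.card - (x.card + C.card) = (S'.card - x.card) by omega, pow_add]; ring
          · intro x hx y hy hxy
            have := congrArg (· \ C) hxy
            simpa [union_sdiff_right, sdiff_eq_self_of_disjoint (hdis x hx),
              sdiff_eq_self_of_disjoint (hdis y hy)] using this
  rw [← sum_filter_add_sum_filter_not T (fun x => a ∈ x)]
  have hsum : p ^ C.card + q ^ C.card ≤ ξ ^ (C ∩ g.support).card := by
    by_cases hga : g a = a
    · have hCa : C = {a} := by
        ext b
        simp only [hC, mem_filter, mem_univ, true_and, mem_singleton]
        constructor
        · rintro ⟨i, hi⟩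
          rw [← hi]; exact Equiv.Perm.zpow_apply_eq_self_of_apply_eq_self hga i
        · rintro rfl; exact Equiv.Perm.SameCycle.refl _ _
      have : C ∩ g.support = ∅ := by
        rw [hCa]; ext b; simp; rintro rfl; exact hga
      rw [this, hCa]; simp [hpq]
    · have : C ∩ g.support = C := by
        rw [inter_eq_left]
        intro b hb
        rw [Equiv.Perm.mem_support]
        intro hb'
        apply hga
        have := (mem_filter.1 hb).2
        exact (this.apply_eq_self_iff).2 hb'
      rw [this]
      apply cyc_bound hp hq hξ h
      have : ({a, g a} : Finset Ω) ⊆ C := by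
        intro b hb
        simp only [mem_insert, mem_singleton] at hb
        rcases hb with rfl | rfl
        · exact haC
        · exact (hCg a).2 haC
      calc 2 = ({a, g a} : Finset Ω).card := (card_pair (Ne.symm hga)).symm
        _ ≤ _ := card_le_card this
  have hfin : (S ∩ g.support).card = (C ∩ g.support).card + (S' ∩ g.support).card := by
    rw [← card_union_of_disjoint, ← union_inter_distrib_right, hS', union_sdiff_of_subset hCS]
    exact disjoint_of_subset_left inter_subset_left
      (disjoint_of_subset_right inter_subset_left disjoint_sdiff)
  calc _ ≤ (p ^ C.card + q ^ C.card) * ∑ x ∈ T', p ^ x.card * q ^ (S'.card - x.card) := by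
        rw [add_mul]; exact add_le_add e2 e1
    _ ≤ ξ ^ (C ∩ g.support).card * ξ ^ (S' ∩ g.support).card := by
        apply mul_le_mul hsum IH (sum_nonneg fun _ _ => nn _ _) (by positivity)
    _ = _ := by rw [hfin, pow_add]

theorem fact_upper (m : ℕ) (hm : 0 < m) :
    (m.factorial : ℝ) ≤ Real.exp 1 * Real.sqrt m * (m / Real.exp 1) ^ m := by
  obtain ⟨k, rfl⟩ : ∃ k, m = k + 1 := ⟨m - 1, by omega⟩
  have h := Stirling.stirlingSeq'_antitone (Nat.zero_le k)
  simp only [Function.comp, Nat.succ_eq_add_one, zero_add, Stirling.stirlingSeq_one] at h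
  rw [Stirling.stirlingSeq, div_le_iff₀ (by positivity), Real.sqrt_mul (by norm_num)] at h
  have h2 : Real.sqrt 2 ≠ 0 := by positivity
  calc _ ≤ _ := h
    _ = _ := by field_simp

theorem choose_lower (n m : ℕ) (hm0 : 0 < m) (hmn : m < n) :
    1 ≤ 3 * Real.sqrt ((m : ℝ) * ((n : ℝ) - m) / n) *
      ((n.choose m : ℝ) * (((m : ℝ) / n) ^ m * (((n : ℝ) - m) / n) ^ (n - m))) := by
  obtain ⟨k, rfl⟩ := Nat.exists_eq_add_of_le hmn.le
  have hk : 0 < k := by omega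
  have e1 := fact_upper m hm0
  have e2 := fact_upper k hk
  have e3 := Stirling.le_factorial_stirling (m + k)
  have hc : ((m + k).choose m : ℝ) * (m.factorial * k.factorial) = (m + k).factorial := by
    have := Nat.add_choose_mul_factorial_mul_factorial m k
    rw [Nat.choose_symm_add.symm] at this
    rw [← mul_assoc]; exact_mod_cast this
  have hconst : Real.exp 1 ^ 2 ≤ 3 * Real.sqrt (2 * Real.pi) := by
    have h1 := Real.exp_one_lt_d9
    have h2 := Real.pi_gt_d2
    have h0 := Real.exp_pos 1
    have : (Real.exp 1 ^ 2 / 3) ≤ Real.sqrt (2 * Real.pi) := by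
      apply Real.le_sqrt_of_sq_le
      have h3 : Real.exp 1 ^ 2 ≤ 7.39 := by nlinarith
      nlinarith [sq_nonneg (Real.exp 1)]
    linarith
  have hm' : (0 : ℝ) < m := by exact_mod_cast hm0
  have hk' : (0 : ℝ) < k := by exact_mod_cast hk
  rw [show m + k - m = k by omega]
  have hcast : ((m + k : ℕ) : ℝ) - m = k := by push_cast; ring
  rw [hcast]
  have hN : (0 : ℝ) < ((m + k : ℕ) : ℝ) := by positivity
  set N : ℝ := ((m + k : ℕ) : ℝ) with hNdef
  rw [Real.sqrt_mul (by positivity)] at e3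
  rw [Real.sqrt_div (by positivity), Real.sqrt_mul (by positivity)]
  have hF : (0 : ℝ) < m.factorial * k.factorial := by positivity
  have hsN : 0 < Real.sqrt N := by positivity
  refine le_of_mul_le_mul_right ?_ hF
  have hE := Real.exp_pos 1
  set E := Real.exp 1
  calc 1 * ((m.factorial : ℝ) * k.factorial)
      ≤ (E * Real.sqrt m * (m / E) ^ m) * (E * Real.sqrt k * (k / E) ^ k) := by
        rw [one_mul]; gcongr
    _ = E ^ 2 * (Real.sqrt m * Real.sqrt k * ((m / E) ^ m * (k / E) ^ k)) := by ring
    _ ≤ (3 * Real.sqrt (2 * Real.pi)) *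
          (Real.sqrt m * Real.sqrt k * ((m / E) ^ m * (k / E) ^ k)) := by gcongr
    _ = 3 * (Real.sqrt m * Real.sqrt k / Real.sqrt N) * ((m / N) ^ m * (k / N) ^ k) *
          (Real.sqrt (2 * Real.pi) * Real.sqrt N * (N / E) ^ (m + k)) := by
        rw [pow_add]; simp only [div_pow]; field_simp
    _ ≤ 3 * (Real.sqrt m * Real.sqrt k / Real.sqrt N) * ((m / N) ^ m * (k / N) ^ k) *
          ((m + k).factorial : ℝ) := by gcongr
    _ = _ := by rw [← hc]; ring

theorem image_eq_iff_inv {Ω : Type*} [DecidableEq Ω] (g : Equiv.Perm Ω) (x : Finset Ω)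
    (h : x.image ⇑g = x) (y : Ω) : g y ∈ x ↔ y ∈ x := by
  conv_lhs => rw [← h]
  simp

theorem fix_bound {Ω : Type*} [Fintype Ω] [DecidableEq Ω] (n m : ℕ)
    (hn : Fintype.card Ω = n) (hm0 : 0 < m) (hmn : m < n) (g : Equiv.Perm Ω) :
    (((powersetCard m (univ : Finset Ω)).filter (fun x => x.image ⇑g = x)).card : ℝ) ≤
      (n.choose m : ℝ) * (3 * Real.sqrt ((m : ℝ) * ((n : ℝ) - m) / n) *
        (Real.sqrt ((m : ℝ) ^ 2 + ((n : ℝ) - m) ^ 2) / n) ^ g.support.card) := by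
  have hm' : (0 : ℝ) < m := by exact_mod_cast hm0
  have hn' : (0 : ℝ) < n := by exact_mod_cast hm0.trans hmn
  have hk' : (0 : ℝ) < (n : ℝ) - m := sub_pos.2 (by exact_mod_cast hmn)
  set p : ℝ := m / n with hp
  set q : ℝ := ((n : ℝ) - m) / n with hq
  set ξ := Real.sqrt ((m : ℝ) ^ 2 + ((n : ℝ) - m) ^ 2) / n with hξ
  have hp0 : 0 < p := by positivity
  have hq0 : 0 < q := by positivity
  have hpq : p + q = 1 := by rw [hp, hq]; field_simp; ring
  have h2 : ξ ^ 2 = p ^ 2 + q ^ 2 := by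
    rw [hξ, div_pow, Real.sq_sqrt (by positivity), hp, hq, div_pow, div_pow, add_div]
  have h1 := inv_bound g hp0.le hq0.le (by positivity : 0 ≤ ξ) hpq h2 _ univ rfl (by simp)
  rw [univ_inter, card_univ, hn] at h1
  set F := (powersetCard m (univ : Finset Ω)).filter (fun x => x.image ⇑g = x) with hF
  have h3 : (F.card : ℝ) * (p ^ m * q ^ (n - m)) ≤ ξ ^ g.support.card := by
    refine le_trans ?_ h1
    calc (F.card : ℝ) * (p ^ m * q ^ (n - m)) = ∑ x ∈ F, p ^ x.card * q ^ (n - x.card) := by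
          rw [← nsmul_eq_mul, ← sum_const]
          apply sum_congr rfl
          intro x hx
          rw [(mem_powersetCard.1 (mem_filter.1 hx).1).2]
      _ ≤ _ := by
          apply sum_le_sum_of_subset_of_nonneg
          · intro x hx
            simp only [mem_filter, mem_powerset]
            exact ⟨subset_univ _, image_eq_iff_inv g x (mem_filter.1 hx).2⟩
          · intros; positivity
  have h4 := choose_lower n m hm0 hmn
  set K := 3 * Real.sqrt ((m : ℝ) * ((n : ℝ) - m) / n)
  have hK : 0 ≤ K := by positivity
  calc (F.card : ℝ) ≤ F.card * (K * ((n.choose m : ℝ) * (p ^ m * q ^ (n - m)))) :=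
        le_mul_of_one_le_right (by positivity) h4
    _ = (n.choose m : ℝ) * (K * (F.card * (p ^ m * q ^ (n - m)))) := by ring
    _ ≤ _ := by gcongr

/-- Theorem 4.3, inequality (29): for a nontrivial permutation group `G` of minimal
degree `μ`, a subset `B` of `G` containing the identity with `B ≠ G`, and
`μ* = min_{g ∈ G∖B} β(g)`, the average stabilizer size of the action of `G` on
`m`-element subsets (`0 < m < n`) satisfies
`⟨Stab⟩_m - 1 < 3 √(m(n-m)/n) (|G| ξ₁^{μ*} + |B| ξ₁^{μ})`. -/
theorem stmt_13 {Ω : Type*} [Fintype Ω] [DecidableEq Ω] (n m : ℕ)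
    (hn : Fintype.card Ω = n) (hm0 : 0 < m) (hmn : m < n)
    (G : Subgroup (Equiv.Perm Ω)) (hG : G ≠ ⊥) (μ : ℕ)
    (hμ : μ = sInf {k : ℕ | ∃ g ∈ G, g ≠ 1 ∧ (Equiv.Perm.support g).card = k})
    (B : Set (Equiv.Perm Ω)) (hBG : B ⊆ (G : Set (Equiv.Perm Ω)))
    (hB1 : (1 : Equiv.Perm Ω) ∈ B) (hBne : B ≠ (G : Set (Equiv.Perm Ω))) (μs : ℕ)
    (hμs : μs = sInf {k : ℕ |
        ∃ g ∈ (G : Set (Equiv.Perm Ω)) \ B, (Equiv.Perm.support g).card = k}) :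
    (∑ x ∈ Finset.powersetCard m (univ : Finset Ω),
          ({g : Equiv.Perm Ω | g ∈ G ∧ x.image ⇑g = x}.ncard : ℝ)) /
        ((Finset.powersetCard m (univ : Finset Ω)).card : ℝ) - 1 <
      3 * Real.sqrt ((m : ℝ) * ((n : ℝ) - m) / n) *
        ((Nat.card G : ℝ) *
            (Real.sqrt ((m : ℝ) ^ 2 + ((n : ℝ) - m) ^ 2) / n) ^ μs +
          (B.ncard : ℝ) *
            (Real.sqrt ((m : ℝ) ^ 2 + ((n : ℝ) - m) ^ 2) / n) ^ μ) := by
  classical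
  have hm' : (0 : ℝ) < m := by exact_mod_cast hm0
  have hn' : (0 : ℝ) < n := by exact_mod_cast hm0.trans hmn
  have hk' : (0 : ℝ) < (n : ℝ) - m := sub_pos.2 (by exact_mod_cast hmn)
  have hfix := fix_bound n m hn hm0 hmn
  have hξ1 : Real.sqrt ((m : ℝ) ^ 2 + ((n : ℝ) - m) ^ 2) / n ≤ 1 := by
    rw [div_le_one hn']
    apply Real.sqrt_le_iff.2 ⟨hn'.le, by nlinarith⟩
  have hξ0 : 0 < Real.sqrt ((m : ℝ) ^ 2 + ((n : ℝ) - m) ^ 2) / n := by positivity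
  have hK : 0 < 3 * Real.sqrt ((m : ℝ) * ((n : ℝ) - m) / n) := by positivity
  set K := 3 * Real.sqrt ((m : ℝ) * ((n : ℝ) - m) / n)
  set ξ := Real.sqrt ((m : ℝ) ^ 2 + ((n : ℝ) - m) ^ 2) / n
  have hcc : (powersetCard m (univ : Finset Ω)).card = n.choose m := by
    rw [card_powersetCard, card_univ, hn]
  have hch : (0 : ℝ) < n.choose m := by exact_mod_cast Nat.choose_pos hmn.le
  set P := powersetCard m (univ : Finset Ω) with hP
  set Gf : Finset (Equiv.Perm Ω) := univ.filter (fun g => g ∈ G) with hGf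
  set Bf : Finset (Equiv.Perm Ω) := univ.filter (fun g => g ∈ B) with hBf
  have hswap : ∑ x ∈ P, ({g : Equiv.Perm Ω | g ∈ G ∧ x.image ⇑g = x}.ncard : ℝ) =
      ∑ g ∈ Gf, ((P.filter (fun x => x.image ⇑g = x)).card : ℝ) := by
    have h1 : ∀ x ∈ P, ({g : Equiv.Perm Ω | g ∈ G ∧ x.image ⇑g = x}.ncard : ℝ) =
        ((Gf.filter (fun g : Equiv.Perm Ω => x.image ⇑g = x)).card : ℝ) := by
      intro x _
      rw [← Set.ncard_coe_finset]
      congr 2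
      ext g
      simp [hGf]
    rw [sum_congr rfl h1]
    simp only [card_filter]
    push_cast
    rw [sum_comm]
  have hGc : (Nat.card G : ℝ) = Gf.card := by
    have : Nat.card G = (G : Set (Equiv.Perm Ω)).ncard := rfl
    rw [this, ← Set.ncard_coe_finset]
    congr 2
    ext g
    simp [hGf]
  have hBc : (B.ncard : ℝ) = Bf.card := by
    rw [← Set.ncard_coe_finset]
    congr 2
    ext g
    simp [hBf]
  have hBGf : Bf ⊆ Gf := by
    intro g hg
    simp only [hBf, hGf, mem_filter, mem_univ, true_and] at hg ⊢
    exact hBG hg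
  have h1B : (1 : Equiv.Perm Ω) ∈ Bf := by simp [hBf, hB1]
  rw [hswap, hcc, hGc, hBc, ← sum_sdiff hBGf, ← sum_erase_add _ _ h1B]
  have hone : (P.filter (fun x => x.image ⇑(1 : Equiv.Perm Ω) = x)).card = n.choose m := by
    rw [← hcc]; simp
  have hA : ∑ g ∈ Gf \ Bf, ((P.filter (fun x => x.image ⇑g = x)).card : ℝ) ≤
      Gf.card * (n.choose m * (K * ξ ^ μs)) := by
    have : ∑ g ∈ Gf \ Bf, ((P.filter (fun x => x.image ⇑g = x)).card : ℝ) ≤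
        (Gf \ Bf).card • (n.choose m * (K * ξ ^ μs)) := by
      apply sum_le_card_nsmul
      intro g hg
      refine (hfix g).trans ?_
      have : μs ≤ g.support.card := by
        rw [hμs]
        apply Nat.sInf_le
        simp only [hBf, hGf, mem_filter, mem_univ, true_and, mem_sdiff] at hg
        exact ⟨g, hg, rfl⟩
      have := pow_le_pow_of_le_one hξ0.le hξ1 this
      gcongr
    rw [nsmul_eq_mul] at this
    refine this.trans ?_
    gcongr
    exact sdiff_subset
  have hB : ∑ g ∈ Bf.erase 1, ((P.filter (fun x => x.image ⇑g = x)).card : ℝ) <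
      Bf.card * (n.choose m * (K * ξ ^ μ)) := by
    have : ∑ g ∈ Bf.erase 1, ((P.filter (fun x => x.image ⇑g = x)).card : ℝ) ≤
        (Bf.erase 1).card • (n.choose m * (K * ξ ^ μ)) := by
      apply sum_le_card_nsmul
      intro g hg
      refine (hfix g).trans ?_
      have : μ ≤ g.support.card := by
        rw [hμ]
        apply Nat.sInf_le
        have hg' := mem_erase.1 hg
        exact ⟨g, (mem_filter.1 (hBGf hg'.2)).2, hg'.1, rfl⟩
      have := pow_le_pow_of_le_one hξ0.le hξ1 this
      gcongr
    rw [nsmul_eq_mul] at this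
    refine this.trans_lt ?_
    have hlt : ((Bf.erase 1).card : ℝ) < Bf.card := by
      exact_mod_cast card_erase_lt_of_mem h1B
    have : 0 < n.choose m * (K * ξ ^ μ) := by positivity
    exact mul_lt_mul_of_pos_right hlt this
  rw [hone, sub_lt_iff_lt_add, div_lt_iff₀ hch]
  nlinarith [hA, hB]
end
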